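/- Let g be a root-reductive Lie algebra with splitting maximal toral subalgebra h and Dynkin Borel subalgebra b ⊇ h. Let λ, ν ∈ h* with λ ≼ ν and let M be an object of the extended category O-bar. Then any two composition series of M with bounds λ and ν are equivalent: if the two series have relevant index sets J and J′, there exists a bijection f: J → J′ such that M_j/M_{j−1} ≅ M′_{f(j)}/M′_{f(j)−1} for all j ∈ J. -/

import Mathlib

noncomputable section
namespace Paper

variable (K : Type) [Field K] [IsAlgClosed K] [CharZero K]
variable (g : Type) [LieRing g] [LieAlgebra K g]

def adWeightSpace (h : LieSubalgebra K g) (α : Module.Dual K h) : Submodule K g where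
  carrier := {x | ∀ H : h, ⁅(H : g), x⁆ = α H • x}
  add_mem' := by intro a b ha hb H; rw [lie_add, ha H, hb H, smul_add]
  zero_mem' := by intro H; rw [lie_zero, smul_zero]
  smul_mem' := by intro c x hx H; rw [lie_smul, hx H, smul_comm]

def IsRootOf (h : LieSubalgebra K g) (α : Module.Dual K h) : Prop :=
  α ≠ 0 ∧ adWeightSpace K g h α ≠ ⊥

def IsToralIn (s t : LieSubalgebra K g) : Prop :=
  t ≤ s ∧ IsLieAbelian t ∧
    s.toSubmodule ≤ ⨆ α : Module.Dual K t, s.toSubmodule ⊓ adWeightSpace K g t α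

def IsMaxToralIn (s t : LieSubalgebra K g) : Prop :=
  IsToralIn K g s t ∧ ∀ t' : LieSubalgebra K g, IsToralIn K g s t' → t ≤ t' → t' = t

/-- A root-reductive Lie algebra `g` together with a splitting maximal toral subalgebra `h`
and a splitting Borel subalgebra `b ⊇ h` determined by a set `pos` of positive roots. -/
structure Setup where
  /-- the exhausting chain of finite-dimensional reductive subalgebras -/
  F : ℕ → LieSubalgebra K g
  F_mono : Monotone F
  F_exhaust : ∀ x : g, ∃ n, x ∈ F n
  F_findim : ∀ n, FiniteDimensional K (F n)
  /-- each `F n` is reductive: every abelian ideal is central -/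
  F_reductive : ∀ n, ∀ I : LieIdeal K (F n), IsLieAbelian I → I ≤ LieAlgebra.center K (F n)
  /-- the nested chain of Cartan subalgebras witnessing the root inclusions -/
  C : ℕ → LieSubalgebra K g
  C_mono : Monotone C
  C_le : ∀ n, C n ≤ F n
  C_cartan : ∀ n, (LieSubalgebra.comap (F n).incl (C n)).IsCartanSubalgebra
  /-- each inclusion `F n ↪ F (n+1)` is a root inclusion with respect to `C (n+1)`:
  every root space of `F n` relative to `C n` is a root space of `F (n+1)` -/
  C_rootIncl : ∀ n, ∀ α : Module.Dual K (C n), α ≠ 0 →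
    (F n).toSubmodule ⊓ adWeightSpace K g (C n) α ≠ ⊥ →
    ∃ β : Module.Dual K (C (n + 1)),
      (F n).toSubmodule ⊓ adWeightSpace K g (C n) α
        = (F (n + 1)).toSubmodule ⊓ adWeightSpace K g (C (n + 1)) β
  /-- the splitting maximal toral subalgebra -/
  h : LieSubalgebra K g
  h_maxToral : ∀ n, IsMaxToralIn K g (F n) (h ⊓ F n)
  /-- `g` is the direct sum of its `h`-weight spaces -/
  h_indep : iSupIndep fun α : Module.Dual K h => adWeightSpace K g h α
  h_span : (⨆ α : Module.Dual K h, adWeightSpace K g h α) = ⊤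
  /-- the set `Δ⁺` of positive roots -/
  pos : Set (Module.Dual K h)
  pos_root : ∀ α ∈ pos, IsRootOf K g h α
  pos_add : ∀ α ∈ pos, ∀ β ∈ pos, IsRootOf K g h (α + β) → α + β ∈ pos
  pos_polar : ∀ α : Module.Dual K h, IsRootOf K g h α → (α ∈ pos ↔ ¬(-α ∈ pos))
  neg_add : ∀ α β : Module.Dual K h, IsRootOf K g h α → IsRootOf K g h β →
    α ∉ pos → β ∉ pos → IsRootOf K g h (α + β) → α + β ∉ pos
  /-- the splitting Borel subalgebra -/
  b : LieSubalgebra K g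
  b_eq : b.toSubmodule = h.toSubmodule ⊔ ⨆ α ∈ pos, adWeightSpace K g h α


variable {K g}

namespace Setup

variable (S : Setup K g)

/-- `h ∩ g_n`. -/
def hn (n : ℕ) : LieSubalgebra K g := S.h ⊓ S.F n

/-- restriction of a functional on `h` to `h ∩ g_n`. -/
def resDual (n : ℕ) (lam : Module.Dual K S.h) : Module.Dual K (S.hn n) :=
  lam.comp (LieSubalgebra.inclusion (inf_le_left : S.hn n ≤ S.h)).toLinearMap

/-- the `α`-root space of `g_n` relative to `h ∩ g_n`. -/
def rootSpaceN (n : ℕ) (α : Module.Dual K (S.hn n)) : Submodule K g :=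
  (S.F n).toSubmodule ⊓ adWeightSpace K g (S.hn n) α

/-- the set of `b`-positive roots of `g_n`. -/
def posRootsN (n : ℕ) : Set (Module.Dual K (S.hn n)) :=
  {α | α ≠ 0 ∧ S.rootSpaceN n α ≠ ⊥ ∧ S.rootSpaceN n α ≤ S.b.toSubmodule}

/-- `ρ_n`, the half sum of the positive roots of `g_n` with respect to `b ∩ g_n`. -/
def rhoN (n : ℕ) : Module.Dual K (S.hn n) :=
  (2 : K)⁻¹ • ∑ᶠ α ∈ S.posRootsN n, α

/-- `α` is a simple `b`-positive root: it is positive and cannot be written as a sum of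
two or more positive roots. -/
def IsSimpleRoot (α : Module.Dual K S.h) : Prop :=
  α ∈ S.pos ∧ ¬∃ s : Multiset (Module.Dual K S.h),
    2 ≤ Multiset.card s ∧ (∀ β ∈ s, β ∈ S.pos) ∧ s.sum = α

/-- `b` is a Dynkin Borel subalgebra: it is generated, as a Lie subalgebra, by `h` together
with the simple root spaces. -/
def IsDynkin : Prop :=
  S.b = LieSubalgebra.lieSpan K g
    ((S.h : Set g) ∪ ⋃ α ∈ {α | S.IsSimpleRoot α}, (adWeightSpace K g S.h α : Set g))

/-- the partial order `≼` on `h^*`: `lam ≼ mu` iff `mu - lam` is a `ℤ≥0`-linear combination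
of positive roots. -/
def wle (lam mu : Module.Dual K S.h) : Prop :=
  ∃ s : Multiset (Module.Dual K S.h), (∀ β ∈ s, β ∈ S.pos) ∧ mu - lam = s.sum

/-- `g` is locally semisimple: each `g_n` is a semisimple Lie algebra. -/
def IsLocallySemisimple : Prop := ∀ n, LieAlgebra.IsSemisimple K (S.F n)

end Setup


/-- the universal enveloping algebra of `g`. -/
abbrev Env (K g : Type) [Field K] [LieRing g] [LieAlgebra K g] : Type :=
  UniversalEnvelopingAlgebra K g

namespace Setup

variable {K : Type} [Field K] [IsAlgClosed K] [CharZero K]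
variable {g : Type} [LieRing g] [LieAlgebra K g]
variable (S : Setup K g)

/-- the nilpotent radical `n⁺ = ⨁_{α ∈ Δ⁺} g^α` of `b`, as a subspace of `g`. -/
def nplus : Submodule K g := ⨆ α ∈ S.pos, adWeightSpace K g S.h α

/-- the left ideal of `U(g)` generated by `n⁺` and the elements `H - lam(H)`, `H ∈ h`. -/
def vermaIdeal (lam : Module.Dual K S.h) : Submodule (Env K g) (Env K g) :=
  Submodule.span (Env K g)
    ((UniversalEnvelopingAlgebra.ι K '' (S.nplus : Set g)) ∪
      Set.range fun H : S.h =>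
        UniversalEnvelopingAlgebra.ι K (H : g) - algebraMap K (Env K g) (lam H))

/-- the Verma module `M(lam) = U(g)/I`. -/
abbrev Verma (lam : Module.Dual K S.h) : Type := Env K g ⧸ S.vermaIdeal lam

/-- the maximal proper submodule of the Verma module `M(lam)`,
i.e. the sum of all proper submodules. -/
def maxSub (lam : Module.Dual K S.h) : Submodule (Env K g) (S.Verma lam) :=
  sSup {N : Submodule (Env K g) (S.Verma lam) | N ≠ ⊤}

/-- the simple module `L(lam)`, the unique simple quotient of `M(lam)`. -/
abbrev SimpleL (lam : Module.Dual K S.h) : Type := S.Verma lam ⧸ S.maxSub lam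

/-- `H` is the coroot `h_α` of the root `α`:  `α(H) = 2` and `H ∈ [g^α, g^{-α}]`. -/
def IsCoroot (α : Module.Dual K S.h) (H : S.h) : Prop :=
  α H = 2 ∧ ∃ x ∈ adWeightSpace K g S.h α, ∃ y ∈ adWeightSpace K g S.h (-α),
    (H : g) = ⁅x, y⁆

/-- the dot-reflection `s_α · mu = mu - (mu + ρ)(h_α) α` associated to a root `α`
with coroot `Hα`, relative to the half sum `ρ` of positive roots. -/
def dotReflect (ρ α : Module.Dual K S.h) (Hα : S.h) (mu : Module.Dual K S.h) :
    Module.Dual K S.h :=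
  mu - ((mu + ρ) Hα) • α

/-- `ρ` is the global half sum of positive roots: its restriction to each `h ∩ g_n`
is the half sum `ρ_n` of positive roots of `g_n`. -/
def IsGlobalRho (ρ : Module.Dual K S.h) : Prop := ∀ n : ℕ, S.resDual n ρ = S.rhoN n

/-- `lam` is strongly linked to `mu` (relative to `ρ`). -/
inductive StronglyLinked (ρ : Module.Dual K S.h) :
    Module.Dual K S.h → Module.Dual K S.h → Prop
  | refl (mu : Module.Dual K S.h) : StronglyLinked ρ mu mu
  | step {lam mu : Module.Dual K S.h} (α : Module.Dual K S.h) (Hα : S.h) :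
      α ∈ S.pos → S.IsCoroot α Hα →
      S.wle (S.dotReflect ρ α Hα mu) mu →
      StronglyLinked ρ lam (S.dotReflect ρ α Hα mu) →
      StronglyLinked ρ lam mu

/-- `lam` is antidominant: `(lam + ρ)(h_α)` is not a positive integer
for any positive root `α`. -/
def IsAntidominant (ρ lam : Module.Dual K S.h) : Prop :=
  ∀ α ∈ S.pos, ∀ Hα : S.h, S.IsCoroot α Hα → ¬∃ k : ℕ, 0 < k ∧ (lam + ρ) Hα = (k : K)

/-- `lam` is almost antidominant: `(lam + ρ)(h_α)` is a positive integer
for only finitely many positive roots `α`. -/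
def IsAlmostAntidominant (ρ lam : Module.Dual K S.h) : Prop :=
  {α | α ∈ S.pos ∧ ∃ Hα : S.h, S.IsCoroot α Hα ∧
    ∃ k : ℕ, 0 < k ∧ (lam + ρ) Hα = (k : K)}.Finite

end Setup

namespace Setup

variable {K : Type} [Field K] [IsAlgClosed K] [CharZero K]
variable {g : Type} [LieRing g] [LieAlgebra K g]
variable (S : Setup K g)

/-- the reflection `s_α : mu ↦ mu - mu(h_α) α`, as a linear map on `h^*`. -/
def reflectionMap (α : Module.Dual K S.h) (Hα : S.h) :
    Module.Dual K S.h →ₗ[K] Module.Dual K S.h where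
  toFun mu := mu - mu Hα • α
  map_add' mu ν := by
    simp only [LinearMap.add_apply, add_smul]
    abel
  map_smul' c mu := by
    simp only [LinearMap.smul_apply, RingHom.id_apply, smul_sub, smul_smul, smul_eq_mul]

/-- the reflection `s_α` associated to a root `α` with coroot `Hα`,
as a linear automorphism of `h^*`. -/
def reflection (α : Module.Dual K S.h) (Hα : S.h) (h2 : α Hα = 2) :
    Module.Dual K S.h ≃ₗ[K] Module.Dual K S.h :=
  LinearEquiv.ofInvolutive (S.reflectionMap α Hα) (by
    intro mu
    show S.reflectionMap α Hα (mu - mu Hα • α) = mu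
    show (mu - mu Hα • α) - ((mu - mu Hα • α) Hα) • α = mu
    rw [LinearMap.sub_apply, LinearMap.smul_apply, h2, smul_eq_mul]
    module)

/-- the Weyl group of `g`, realized as the group of linear automorphisms of `h^*`
generated by the reflections in the roots. -/
def weylGroup : Subgroup (Module.Dual K S.h ≃ₗ[K] Module.Dual K S.h) :=
  Subgroup.closure
    {w | ∃ (α : Module.Dual K S.h) (Hα : S.h) (hc : S.IsCoroot α Hα),
      IsRootOf K g S.h α ∧ w = S.reflection α Hα hc.1}

/-- the dot action `w · mu = w(mu + ρ) - ρ`. -/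
def dotAct (ρ : Module.Dual K S.h) (w : Module.Dual K S.h ≃ₗ[K] Module.Dual K S.h)
    (mu : Module.Dual K S.h) : Module.Dual K S.h :=
  w (mu + ρ) - ρ

/-- the root lattice `Λ`, the `ℤ`-span of the roots in `h^*`. -/
def rootLattice : Submodule ℤ (Module.Dual K S.h) :=
  Submodule.span ℤ {α : Module.Dual K S.h | IsRootOf K g S.h α}

end Setup

variable {K : Type} [Field K] [IsAlgClosed K] [CharZero K]
variable {g : Type} [LieRing g] [LieAlgebra K g]

lemma env_smul_comm {M : Type} [AddCommGroup M] [Module K M] [Module (Env K g) M]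
    [IsScalarTower K (Env K g) M] (c : K) (r : Env K g) (m : M) :
    r • (c • m) = c • (r • m) := by
  rw [← algebraMap_smul (Env K g) c m, ← mul_smul, ← Algebra.commutes, mul_smul,
    algebraMap_smul]

namespace Setup

variable (S : Setup K g)

section Modules

variable (M : Type) [AddCommGroup M] [Module K M] [Module (Env K g) M]
  [IsScalarTower K (Env K g) M]

/-- the `lam`-weight space of a `U(g)`-module `M`. -/
def wtSpace (lam : Module.Dual K S.h) : Submodule K M where
  carrier := {m | ∀ H : S.h, UniversalEnvelopingAlgebra.ι K (H : g) • m = lam H • m}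
  add_mem' := by
    intro a b ha hb H
    rw [smul_add, ha H, hb H, smul_add]
  zero_mem' := by
    intro H
    rw [smul_zero, smul_zero]
  smul_mem' := by
    intro c x hx H
    rw [env_smul_comm, hx H, smul_comm]

/-- the support of `M`: the set of `h`-weights of `M`. -/
def support : Set (Module.Dual K S.h) := {lam | S.wtSpace M lam ≠ ⊥}

/-- `M` is an object of the extended category `O-bar`:  it is an `h`-weight module with
finite-dimensional weight spaces and `U(n⁺) ⬝ v` is finite dimensional for every `v ∈ M`. -/
structure InO : Prop where
  indep : iSupIndep fun lam : Module.Dual K S.h => S.wtSpace M lam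
  span : (⨆ lam : Module.Dual K S.h, S.wtSpace M lam) = ⊤
  finite : ∀ lam : Module.Dual K S.h, FiniteDimensional K (S.wtSpace M lam)
  locFin : ∀ v : M, ∃ N : Submodule K M, FiniteDimensional K N ∧ v ∈ N ∧
    ∀ x ∈ S.nplus, ∀ m ∈ N, UniversalEnvelopingAlgebra.ι K x • m ∈ N

end Modules

end Setup

/-- a `U(g)`-module is indecomposable if it is nonzero and is not the direct sum of two
nonzero submodules. -/
def Indecomposable (M : Type) [AddCommGroup M] [Module (Env K g) M] : Prop :=
  (⊤ : Submodule (Env K g) M) ≠ ⊥ ∧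
    ∀ N₁ N₂ : Submodule (Env K g) M, IsCompl N₁ N₂ → N₁ = ⊥ ∨ N₂ = ⊥

/-- the subquotient `N₂ / N₁` of a pair of submodules. -/
abbrev subQuot {M : Type} [AddCommGroup M] [Module (Env K g) M]
    (N₁ N₂ : Submodule (Env K g) M) : Type :=
  N₂ ⧸ (N₁.comap N₂.subtype)

namespace Setup

variable (S : Setup K g)

/-- A composition series of `M` with bounds `lam ≼ nu`: a finite filtration of `M` together
with a relevant index set `J` such that relevant subquotients are simple modules `L(ξ)` with
`lam ≼ ξ ≼ nu`, and irrelevant subquotients either have no weights in the interval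
`[lam, nu]` or are simple modules `L(ξ)` with `ξ ≻ lam` and `ξ ⋠ nu`. -/
structure CompSeries (lam nu : Module.Dual K S.h) (M : Type) [AddCommGroup M] [Module K M]
    [Module (Env K g) M] [IsScalarTower K (Env K g) M] where
  k : ℕ
  c : Fin (k + 1) → Submodule (Env K g) M
  mono : Monotone c
  bot : c 0 = ⊥
  top : c (Fin.last k) = ⊤
  J : Finset (Fin k)
  rel : ∀ j ∈ J, ∃ ξ : Module.Dual K S.h, S.wle lam ξ ∧ S.wle ξ nu ∧
    Nonempty (subQuot (c j.castSucc) (c j.succ) ≃ₗ[Env K g] S.SimpleL ξ)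
  irrel : ∀ j : Fin k, j ∉ J →
    (∀ mu : Module.Dual K S.h, S.wle lam mu → S.wle mu nu →
        S.wtSpace (subQuot (c j.castSucc) (c j.succ)) mu = ⊥) ∨
    (∃ ξ : Module.Dual K S.h, S.wle lam ξ ∧ ξ ≠ lam ∧ ¬S.wle ξ nu ∧
        Nonempty (subQuot (c j.castSucc) (c j.succ) ≃ₗ[Env K g] S.SimpleL ξ))

/-- the `j`-th subquotient of a composition series. -/
abbrev CompSeries.quot {S : Setup K g} {lam nu : Module.Dual K S.h} {M : Type}
    [AddCommGroup M] [Module K M] [Module (Env K g) M] [IsScalarTower K (Env K g) M]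
    (T : S.CompSeries lam nu M) (j : Fin T.k) : Type :=
  subQuot (T.c j.castSucc) (T.c j.succ)

/-- the number of times the simple module `L(mu)` occurs in the composition series `T`. -/
noncomputable def CompSeries.mult {S : Setup K g} {lam nu : Module.Dual K S.h} {M : Type}
    [AddCommGroup M] [Module K M] [Module (Env K g) M] [IsScalarTower K (Env K g) M]
    (T : S.CompSeries lam nu M) (mu : Module.Dual K S.h) : ℕ :=
  Nat.card {j : Fin T.k // j ∈ T.J ∧ Nonempty (T.quot j ≃ₗ[Env K g] S.SimpleL mu)}

/-- `L(mu)` is a composition factor of `M`: it occurs in some composition series of `M`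
with bounds `lam ≼ mu ≼ nu`. -/
def IsCompFactor (M : Type) [AddCommGroup M] [Module K M] [Module (Env K g) M]
    [IsScalarTower K (Env K g) M] (mu : Module.Dual K S.h) : Prop :=
  ∃ (lam nu : Module.Dual K S.h) (T : S.CompSeries lam nu M),
    S.wle lam mu ∧ S.wle mu nu ∧
    ∃ j ∈ T.J, Nonempty (T.quot j ≃ₗ[Env K g] S.SimpleL mu)

end Setup

/-- A generalized composition series of `M`: a family of submodules indexed by a totally
ordered set `(J, <)`, strictly increasing, with trivial intersection, union equal to `M`,
and all subquotients `M_j / M_{<j}` simple. -/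
structure GenCompSeries (M : Type) [AddCommGroup M] [Module (Env K g) M] where
  J : Type
  lt : J → J → Prop
  linear : IsLinearOrder J lt
  c : J → Submodule (Env K g) M
  strict : ∀ {i j : J}, lt i j → c i < c j
  iInf_bot : (⨅ j, c j) = ⊥
  iSup_top : (⨆ j, c j) = ⊤
  simple : ∀ j : J,
    IsSimpleModule (Env K g) (subQuot (⨆ i : {i : J // lt i j}, c i) (c j))

/-- the subquotient `M_j / M_{<j}` of a generalized composition series. -/
abbrev GenCompSeries.quot {M : Type} [AddCommGroup M] [Module (Env K g) M]
    (T : GenCompSeries (K := K) (g := g) M) (j : T.J) : Type :=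
  subQuot (⨆ i : {i : T.J // T.lt i j}, T.c i) (T.c j)

end Paper

set_option linter.unusedSectionVars false

theorem exists_stable_of_generator {K L V : Type*} [Field K] [LieRing L] [LieAlgebra K L]
    [AddCommGroup V] [Module K V] (f : L →ₗ[K] Module.End K V)
    (hf : ∀ x y m, f ⁅x, y⁆ m = f x (f y m) - f y (f x m))
    (b n : Submodule K L) (hbn : b ⊔ n = ⊤) (v : V) (hv : ∀ x ∈ b, f x v ∈ Submodule.span K {v})
    (P : Submodule K V) (hvP : v ∈ P) (hP : ∀ y ∈ n, ∀ m ∈ P, f y m ∈ P) :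
    ∃ N ≤ P, v ∈ N ∧ ∀ x, ∀ m ∈ N, f x m ∈ N := by
  set N : Submodule K V := sInf {Q | v ∈ Q ∧ ∀ y ∈ n, ∀ m ∈ Q, f y m ∈ Q} with hN
  have hvN : v ∈ N := by
    simp only [hN, Submodule.mem_sInf]
    exact fun Q hQ => hQ.1
  have hnN : ∀ y ∈ n, ∀ m ∈ N, f y m ∈ N := by
    intro y hy m hm
    simp only [hN, Submodule.mem_sInf] at hm ⊢
    exact fun Q hQ => hQ.2 y hy m (hm Q hQ)
  have hmin : ∀ Q : Submodule K V, v ∈ Q → (∀ y ∈ n, ∀ m ∈ Q, f y m ∈ Q) → N ≤ Q :=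
    fun Q h1 h2 => sInf_le ⟨h1, h2⟩
  let N' : Submodule K V :=
    { carrier := {m | m ∈ N ∧ ∀ x ∈ b, f x m ∈ N}
      add_mem' := fun {p q} hp hq => ⟨N.add_mem hp.1 hq.1, fun x hx => by
        rw [map_add]; exact N.add_mem (hp.2 x hx) (hq.2 x hx)⟩
      zero_mem' := ⟨N.zero_mem, fun x _ => by rw [map_zero]; exact N.zero_mem⟩
      smul_mem' := fun c p hp => ⟨N.smul_mem c hp.1, fun x hx => by
        rw [map_smul]; exact N.smul_mem c (hp.2 x hx)⟩ }
  have hsplit : ∀ m ∈ N', ∀ x, f x m ∈ N := by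
    intro m hm x
    obtain ⟨p, hp, q, hq, rfl⟩ := Submodule.mem_sup.1 (hbn ▸ Submodule.mem_top : x ∈ b ⊔ n)
    rw [map_add, LinearMap.add_apply]
    exact N.add_mem (hm.2 p hp) (hnN q hq m hm.1)
  have hle : N ≤ N' := by
    refine hmin N' ⟨hvN, fun x hx => ?_⟩ fun y hy m hm => ⟨hnN y hy m hm.1, fun x hx => ?_⟩
    · exact (Submodule.span_singleton_le_iff_mem v N).2 hvN (hv x hx)
    · have h := hf x y m
      rw [eq_sub_iff_add_eq] at h
      rw [← h]
      exact N.add_mem (hsplit m hm _) (hnN y hy _ (hm.2 x hx))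
  exact ⟨N, hmin P hvP hP, hvN, fun x m hm => hsplit m (hle hm) x⟩

/-- Components with respect to distinct joint eigenvalues of a member of a stable subspace. -/
theorem weight_components_mem {K V ι κ : Type*} [Field K] [AddCommGroup V] [Module K V]
    (T : ι → Module.End K V) (N : Submodule K V) (hN : ∀ i, ∀ m ∈ N, T i m ∈ N)
    (s : Finset κ) (w : κ → ι → K) (hw : Set.InjOn w s) (m : κ → V)
    (hm : ∀ a ∈ s, ∀ i, T i (m a) = w a i • m a) (hsum : ∑ a ∈ s, m a ∈ N) :
    ∀ a ∈ s, m a ∈ N := by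
  classical
  induction s using Finset.induction_on generalizing m with
  | empty => simp
  | insert a s ha ih =>
    have key : ∀ c ∈ s, m c ∈ N := by
      intro c hc
      have hne : w c ≠ w a := fun h =>
        ha (by rwa [← hw (by simp [hc]) (by simp) h])
      obtain ⟨i, hi⟩ := Function.ne_iff.1 hne
      have h1 : ∑ d ∈ s, (w d i - w a i) • m d ∈ N := by
        have h2 : T i (∑ d ∈ insert a s, m d) - w a i • ∑ d ∈ insert a s, m d ∈ N :=
          N.sub_mem (hN i _ hsum) (N.smul_mem _ hsum)
        rw [map_sum, Finset.smul_sum, ← Finset.sum_sub_distrib, Finset.sum_insert ha,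
          hm a (by simp) i, sub_self, zero_add] at h2
        convert h2 using 1
        refine Finset.sum_congr rfl fun d hd => ?_
        rw [hm d (by simp [hd]) i, sub_smul]
      have h3 := ih (hw.mono (by simp)) (fun d => (w d i - w a i) • m d)
        (fun d hd j => by rw [map_smul, hm d (by simp [hd]) j, smul_comm]) h1 c hc
      exact (N.smul_mem_iff (sub_ne_zero.2 hi)).1 h3
    intro c hc
    rcases Finset.mem_insert.1 hc with rfl | hc
    · rw [Finset.sum_insert ha] at hsum
      exact (N.add_mem_iff_left (N.sum_mem key)).1 hsum
    · exact key c hc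

section Killing

variable {K L V : Type*} [Field K] [IsAlgClosed K] [CharZero K] [LieRing L] [LieAlgebra K L]
  [FiniteDimensional K L] [LieAlgebra.IsKilling K L]
  (H : LieSubalgebra K L) [H.IsCartanSubalgebra]
  [AddCommGroup V] [Module K V] [FiniteDimensional K V] [LieRingModule L V] [LieModule K L V]

open LieAlgebra LieModule

theorem iSup_rootSpace_eq_top :
    ⨆ α : Weight K H L, (rootSpace H α).toSubmodule = ⊤ := by
  rw [← LieSubmodule.iSup_toSubmodule, iSup_genWeightSpace_eq_top', LieSubmodule.top_toSubmodule]

theorem lie_mem_weightSpace_add {α χ : H → K} {x : L} {v : V} (hx : x ∈ rootSpace H α)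
    (hv : v ∈ weightSpace V χ) : ⁅x, v⁆ ∈ weightSpace V (α + χ) := by
  rw [mem_weightSpace] at hv ⊢
  intro y
  have h1 : ⁅(y : L), x⁆ = α y • x := IsKilling.lie_eq_smul_of_mem_rootSpace hx y
  have h2 : ⁅(y : L), v⁆ = χ y • v := hv y
  change ⁅(y : L), ⁅x, v⁆⁆ = _
  rw [leibniz_lie, h1, h2, smul_lie, lie_smul, Pi.add_apply, add_smul]

theorem iSup_weightSpace_eq_top [LieModule.IsIrreducible K L V] :
    ⨆ χ : H → K, (weightSpace V χ).toSubmodule = ⊤ := by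
  let W : LieSubmodule K L V :=
    { (⨆ χ : H → K, (weightSpace V χ).toSubmodule : Submodule K V) with
      lie_mem := by
        intro x m hm
        change ⁅x, m⁆ ∈ (⨆ χ : H → K, (weightSpace V χ).toSubmodule : Submodule K V)
        have hx : x ∈ ⨆ α : Weight K H L, (rootSpace H α).toSubmodule := by
          rw [iSup_rootSpace_eq_top]; trivial
        induction hx using Submodule.iSup_induction' with
        | mem α x hx =>
          induction hm using Submodule.iSup_induction' with
          | mem χ m hm =>
            exact Submodule.mem_iSup_of_mem (α + χ) (lie_mem_weightSpace_add H hx hm)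
          | zero => rw [lie_zero]; exact Submodule.zero_mem _
          | add p q _ _ hp hq => rw [lie_add]; exact Submodule.add_mem _ hp hq
        | zero => rw [zero_lie]; exact Submodule.zero_mem _
        | add p q _ _ hp hq => rw [add_lie]; exact Submodule.add_mem _ hp hq }
  have : Nontrivial V := LieModule.nontrivial_of_isIrreducible K L V
  obtain ⟨χ, hχ⟩ := exists_nontrivial_weightSpace_of_isNilpotent K H V
  have hW : W ≠ ⊥ := by
    intro h0
    obtain ⟨v, hv⟩ := exists_ne (0 : weightSpace V χ)
    have hmem : (v : V) ∈ W := Submodule.mem_iSup_of_mem (χ : H → K) v.2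
    rw [h0, LieSubmodule.mem_bot] at hmem
    exact hv (Subtype.ext hmem)
  have hT : W = ⊤ := (eq_bot_or_eq_top W).resolve_left hW
  exact congrArg LieSubmodule.toSubmodule hT

end Killing

section Killing

variable {K L : Type*} [Field K] [IsAlgClosed K] [CharZero K] [LieRing L] [LieAlgebra K L]
  [FiniteDimensional K L] [LieAlgebra.IsKilling K L]
  (H : LieSubalgebra K L) [H.IsCartanSubalgebra]

open LieAlgebra LieModule

theorem nonempty_root_of_isKilling [Nontrivial L] : Nonempty (H.root) := by
  by_contra hempty
  have hz : ∀ α : Weight K H L, α.IsZero := by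
    intro α
    by_contra h
    exact hempty ⟨⟨α, by simpa using h⟩⟩
  have hspan := IsKilling.span_weight_isNonZero_eq_top K L H
  have he : {α : Weight K H L | α.IsNonZero} = ∅ := by
    ext α; simpa using hz α
  rw [he, Set.image_empty, Submodule.span_empty] at hspan
  have hH : ∀ y : H, y = 0 := by
    intro y
    refine (Module.forall_dual_apply_eq_zero_iff K y).1 fun f => ?_
    have : f ∈ (⊥ : Submodule K (Module.Dual K H)) := hspan ▸ Submodule.mem_top
    rw [(Submodule.mem_bot K).1 this, LinearMap.zero_apply]
  have htop := iSup_rootSpace_eq_top (K := K) (L := L) H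
  obtain ⟨x, hx⟩ := exists_ne (0 : L)
  have hle : ⨆ α : Weight K H L, (rootSpace H α).toSubmodule ≤ ⊥ := by
    refine iSup_le fun α z hzα => ?_
    have h0 : (α : H → K) = 0 := hz α
    rw [LieSubmodule.mem_toSubmodule, h0, rootSpace_zero_eq] at hzα
    have : (⟨z, hzα⟩ : H) = 0 := hH _
    exact congrArg Subtype.val this
  rw [htop] at hle
  exact hx (hle Submodule.mem_top)

/-- A principal `sl₂`-triple with respect to a splitting Cartan subalgebra. -/
theorem exists_principal_sl2 [Nontrivial L] :
    ∃ (y : H) (E F : L), IsSl2Triple (y : L) E F ∧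
      E ∈ ⨆ (α : Weight K H L) (_ : α y = 2), (rootSpace H α).toSubmodule ∧
      ∀ α : Weight K H L, α.IsNonZero →
        ∃ n : ℕ, n ≠ 0 ∧ (α y = 2 * n ∨ α y = -(2 * n)) := by
  classical
  let P := IsKilling.rootSystem H
  obtain ⟨b⟩ := RootPairing.nonempty_base P
  let ℓ : Module.Dual K (Module.Dual K H) := b.toWeightBasis.constr K fun _ => (2 : K)
  let y : H := (Module.evalEquiv K H).symm ℓ
  have hy : ∀ i ∈ b.support, P.root i y = 2 := by
    intro i hi
    have h1 : P.root i y = ℓ (P.root i) := Module.apply_evalEquiv_symm_apply K H _ _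
    have h2 := b.toWeightBasis.constr_basis K (fun _ => (2 : K)) ⟨i, hi⟩
    rw [RootPairing.Base.toWeightBasis_apply] at h2
    exact h1.trans h2
  have hnz : ∀ i : H.root, (i : Weight K H L).IsNonZero := fun i => (Finset.mem_filter.1 i.2).2
  choose h e f ht he hf using fun i : H.root =>
    IsKilling.exists_isSl2Triple_of_weight_isNonZero (hnz i)
  have hh : ∀ i, h i = (P.coroot i : L) := fun i => by
    rw [(ht i).h_eq_coroot (hnz i) (he i) (hf i), IsKilling.rootSystem_coroot_apply]
  let c : H.root → K := fun i => if hi : i ∈ b.support then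
    b.toCoweightBasis.repr y ⟨i, hi⟩ else 0
  have hc : (y : L) = ∑ i ∈ b.support, c i • h i := by
    have h1 := b.toCoweightBasis.sum_repr y
    rw [← Finset.sum_coe_sort b.support]
    conv_lhs => rw [← h1]
    rw [AddSubmonoidClass.coe_finsetSum]
    refine Finset.sum_congr rfl fun i _ => ?_
    simp only [RootPairing.Base.toCoweightBasis_apply, c, i.2, dif_pos, hh]
    rfl
  have hroot : ∀ i, ∀ z : H, P.root i z = (i : Weight K H L) z := fun i z => by
    rw [IsKilling.rootSystem_root_apply]; rfl
  have hef : ∀ i ∈ b.support, ∀ j ∈ b.support, i ≠ j → ⁅e i, f j⁆ = 0 := by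
    intro i hi j hj hij
    have h1 := lie_mem_genWeightSpace_of_mem_genWeightSpace (he i) (hf j)
    by_contra hne
    have hbot : genWeightSpace L ((i : Weight K H L) + -(j : Weight K H L) : H → K) ≠ ⊥ := by
      intro h0
      rw [h0, LieSubmodule.mem_bot] at h1
      exact hne h1
    let γ : Weight K H L := ⟨_, hbot⟩
    have hγ : γ.IsNonZero := by
      intro h0
      have h2 : ((i : Weight K H L) + -(j : Weight K H L) : H → K) = 0 := h0
      apply hij
      apply P.root.injective
      ext z
      have h3 := congrFun h2 z
      rw [hroot, hroot]
      simpa [add_neg_eq_zero] using h3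
    refine b.sub_notMem_range_root hi hj ⟨⟨γ, by simpa using hγ⟩, ?_⟩
    ext z
    rw [LinearMap.sub_apply, hroot, hroot, hroot]
    change (i : Weight K H L) z + -(j : Weight K H L) z = _
    ring
  have hlin : ∀ α : Weight K H L, α.IsNonZero →
      ∃ n : ℕ, n ≠ 0 ∧ (α y = 2 * n ∨ α y = -(2 * n)) := by
    intro α hα
    obtain ⟨m, -, hm⟩ := b.exists_root_eq_sum_nat_or_neg ⟨α, by simpa using hα⟩
    have hs : (∑ j ∈ b.support, m j • P.root j) y = 2 * ((∑ j ∈ b.support, m j : ℕ) : K) := by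
      rw [LinearMap.sum_apply, Nat.cast_sum, Finset.mul_sum]
      refine Finset.sum_congr rfl fun j hj => ?_
      rw [LinearMap.smul_apply, hy j hj, nsmul_eq_mul, mul_comm]
    have hα' : P.root ⟨α, by simpa using hα⟩ y = α y := hroot _ _
    refine ⟨∑ j ∈ b.support, m j, fun h0 => ?_, ?_⟩
    · have h1 : ∀ j ∈ b.support, m j = 0 := Finset.sum_eq_zero_iff.1 h0
      have h2 : ∑ j ∈ b.support, m j • P.root j = 0 :=
        Finset.sum_eq_zero fun j hj => by rw [h1 j hj, zero_smul]
      rw [h2, neg_zero, or_self] at hm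
      exact P.ne_zero _ hm
    · rw [← hα', ← hs]
      rcases hm with hm | hm
      · left; exact congrArg (fun ψ : Module.Dual K H => ψ y) hm
      · right; exact congrArg (fun ψ : Module.Dual K H => ψ y) hm
  have hye : ∀ i ∈ b.support, ⁅(y : L), e i⁆ = (2 : K) • e i := fun i hi => by
    have h1 := IsKilling.lie_eq_smul_of_mem_rootSpace (he i) y
    rw [← hroot, hy i hi] at h1
    exact h1
  have hyf : ∀ i ∈ b.support, ⁅(y : L), f i⁆ = (-2 : K) • f i := fun i hi => by
    have h1 := IsKilling.lie_eq_smul_of_mem_rootSpace (hf i) y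
    rw [Pi.neg_apply, ← hroot, hy i hi] at h1
    exact h1
  refine ⟨y, ∑ i ∈ b.support, e i, ∑ i ∈ b.support, c i • f i, ⟨?_, ?_, ?_, ?_⟩, ?_, hlin⟩
  · intro h0
    have : Nonempty H.root := nonempty_root_of_isKilling H
    obtain ⟨i, hi⟩ := b.support_nonempty
    have h1 := hy i hi
    rw [show y = 0 from Subtype.ext h0, map_zero] at h1
    exact two_ne_zero h1.symm
  · rw [sum_lie_sum, hc]
    refine Finset.sum_congr rfl fun i hi => ?_
    rw [Finset.sum_eq_single_of_mem i hi]
    · rw [lie_smul, (ht i).lie_e_f]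
    · intro j hj hji
      rw [lie_smul, hef i hi j hj hji.symm, smul_zero]
  · rw [lie_sum, Finset.smul_sum]
    refine Finset.sum_congr rfl fun i hi => ?_
    rw [hye i hi, ofNat_smul_eq_nsmul]
  · rw [lie_sum, Finset.smul_sum, ← Finset.sum_neg_distrib]
    refine Finset.sum_congr rfl fun i hi => ?_
    rw [lie_smul, hyf i hi, smul_comm, neg_smul, ofNat_smul_eq_nsmul]
  · refine Submodule.sum_mem _ fun i hi => ?_
    refine Submodule.mem_iSup_of_mem (i : Weight K H L) (Submodule.mem_iSup_of_mem ?_ (he i))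
    rw [← hroot, hy i hi]

end Killing

section Killing

variable {K L V : Type*} [Field K] [IsAlgClosed K] [CharZero K] [LieRing L] [LieAlgebra K L]
  [FiniteDimensional K L] [LieAlgebra.IsKilling K L]
  (H : LieSubalgebra K L) [H.IsCartanSubalgebra]
  [AddCommGroup V] [Module K V] [FiniteDimensional K V] [LieRingModule L V] [LieModule K L V]

open LieAlgebra LieModule

theorem form_pow_lie (ω : V →ₗ[K] V →ₗ[K] K)
    (hinv : ∀ (x : L) v w, ω ⁅x, v⁆ w + ω v ⁅x, w⁆ = 0) (x : L) (k : ℕ) (v w : V) :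
    ω ((toEnd K L V x ^ k) v) w = (-1) ^ k * ω v ((toEnd K L V x ^ k) w) := by
  induction k generalizing v w with
  | zero => simp
  | succ k ih =>
    have h1 := hinv x ((toEnd K L V x ^ k) v) w
    have h2 : ω ((toEnd K L V x ^ (k + 1)) v) w = - ω ((toEnd K L V x ^ k) v) ⁅x, w⁆ := by
      rw [pow_succ', Module.End.mul_apply, toEnd_apply_apply]
      exact eq_neg_of_add_eq_zero_left h1
    rw [h2, ih, pow_succ (toEnd K L V x), Module.End.mul_apply, toEnd_apply_apply]
    ring

/-- An irreducible module carrying a nonzero invariant alternating form has no nonzero vector of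
weight zero. -/
theorem eq_zero_of_forall_lie_eq_zero_of_alternating [LieModule.IsIrreducible K L V]
    (ω : V →ₗ[K] V →ₗ[K] K)
    (halt : ∀ v, ω v v = 0) (hinv : ∀ (x : L) v w, ω ⁅x, v⁆ w + ω v ⁅x, w⁆ = 0) (hne : ω ≠ 0)
    (v₀ : V) (hv₀ : ∀ y : H, ⁅(y : L), v₀⁆ = 0) : v₀ = 0 := by
  by_contra hv₀ne
  have hgen : ∀ (N : Submodule K V), (∀ x : L, ∀ m ∈ N, ⁅x, m⁆ ∈ N) → ∀ v ∈ N, v ≠ 0 →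
      N = ⊤ := by
    intro N hN v hv hv0
    let N' : LieSubmodule K L V := { N with lie_mem := fun {x m} hm => hN x m hm }
    have h1 : N' ≠ ⊥ := by
      intro h0
      have hm : v ∈ N' := hv
      rw [h0, LieSubmodule.mem_bot] at hm
      exact hv0 hm
    exact congrArg LieSubmodule.toSubmodule ((eq_bot_or_eq_top N').resolve_left h1)
  rcases subsingleton_or_nontrivial L with hL | hL
  · have htop := hgen (Submodule.span K {v₀})
      (fun x m _ => by rw [Subsingleton.elim x 0, zero_lie]; exact Submodule.zero_mem _)
      v₀ (Submodule.mem_span_singleton_self v₀) hv₀ne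
    apply hne
    ext a b
    obtain ⟨s, rfl⟩ := Submodule.mem_span_singleton.1 (htop ▸ Submodule.mem_top : a ∈ _)
    obtain ⟨t, rfl⟩ := Submodule.mem_span_singleton.1 (htop ▸ Submodule.mem_top : b ∈ _)
    simp [halt]
  obtain ⟨y, E, F, ht, hE, hroots⟩ := exists_principal_sl2 (K := K) H
  let S : Set ℕ := {n | ∃ (χ : H → K) (v : V), v ≠ 0 ∧ v ∈ weightSpace V χ ∧ χ y = 2 * n}
  have h0S : 0 ∈ S := ⟨0, v₀, hv₀ne, (mem_weightSpace _ _).2 fun z => by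
    rw [Pi.zero_apply, zero_smul]; exact hv₀ z, by simp⟩
  have hSfin : S.Finite := by
    refine Set.Finite.of_finite_image (f := fun n : ℕ => (2 * n : K))
      ((Module.End.finite_hasEigenvalue (toEnd K L V (y : L))).subset ?_) ?_
    · rintro _ ⟨n, ⟨χ, v, hv, hvχ, hχ⟩, rfl⟩
      refine Module.End.hasEigenvalue_of_hasEigenvector (x := v)
        ⟨Module.End.mem_eigenspace_iff.2 ?_, hv⟩
      have := (mem_weightSpace _ _).1 hvχ y
      rw [hχ] at this
      exact this
    · intro a _ b _ hab
      simpa using hab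
  obtain ⟨χ, v, hv0, hvχ, hχ⟩ := Nat.sSup_mem ⟨0, h0S⟩ hSfin.bddAbove
  set n := sSup S with hn
  have hpos : ∀ α : Weight K H L, ∀ m : ℕ, m ≠ 0 → α y = 2 * m → ∀ x ∈ rootSpace H α,
      ⁅x, v⁆ = 0 := by
    intro α m hm hα x hx
    by_contra hne'
    have h1 : n + m ∈ S := ⟨α + χ, ⁅x, v⁆, hne', lie_mem_weightSpace_add H hx hvχ, by
      rw [Pi.add_apply, hα, hχ]; push_cast; ring⟩
    have h2 := le_csSup hSfin.bddAbove h1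
    rw [← hn] at h2
    omega
  have hEv : ⁅E, v⁆ = 0 := by
    clear ht
    induction hE using Submodule.iSup_induction' with
    | mem α x hx =>
      induction hx using Submodule.iSup_induction' with
      | mem hα x hx => exact hpos α 1 one_ne_zero (by rw [hα]; simp) x hx
      | zero => rw [zero_lie]
      | add p q _ _ hp hq => rw [add_lie, hp, hq, add_zero]
    | zero => rw [zero_lie]
    | add p q _ _ hp hq => rw [add_lie, hp, hq, add_zero]
  have hyv : ⁅(y : L), v⁆ = (2 * n : K) • v := by
    have := (mem_weightSpace _ _).1 hvχ y
    rw [hχ] at this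
    exact this
  have hprim : ht.HasPrimitiveVectorWith v ((2 * n : ℕ) : K) :=
    ⟨hv0, by rw [hyv]; push_cast; rfl, hEv⟩
  set u := (toEnd K L V F ^ (2 * n)) v with hu
  have hu0 : u ≠ 0 := hprim.pow_toEnd_f_ne_zero_of_eq_nat rfl le_rfl
  have hyu : ⁅(y : L), u⁆ = (-(2 * n) : K) • u := by
    rw [hu, hprim.lie_h_pow_toEnd_f]
    congr 1
    push_cast
    ring
  have hskew : ∀ a b, ω a b = - ω b a := by
    intro a b
    have := halt (a + b)
    simp only [map_add, LinearMap.add_apply, halt, zero_add, add_zero] at this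
    exact eq_neg_of_add_eq_zero_right this
  have hωvu : ω v u = 0 := by
    have h1 := form_pow_lie ω hinv F (2 * n) v v
    rw [← hu, pow_mul, neg_one_sq, one_pow, one_mul, hskew u v] at h1
    exact self_eq_neg.1 h1.symm
  -- the highest weight vector generates the module
  let b : Submodule K L := H.toSubmodule ⊔
    ⨆ (α : Weight K H L) (_ : ∃ m : ℕ, m ≠ 0 ∧ α y = 2 * m), (rootSpace H α).toSubmodule
  let nn : Submodule K L :=
    ⨆ (α : Weight K H L) (_ : ∃ m : ℕ, m ≠ 0 ∧ α y = -(2 * m)), (rootSpace H α).toSubmodule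
  have hbn : b ⊔ nn = ⊤ := by
    rw [eq_top_iff, ← iSup_rootSpace_eq_top H]
    refine iSup_le fun α => ?_
    by_cases hα : α.IsNonZero
    · obtain ⟨m, hm, h | h⟩ := hroots α hα
      · exact (le_iSup₂_of_le (f := fun (α : Weight K H L)
          (_ : ∃ m : ℕ, m ≠ 0 ∧ α y = 2 * m) => (rootSpace H α).toSubmodule)
          α ⟨m, hm, h⟩ le_rfl).trans (le_sup_right.trans le_sup_left)
      · exact (le_iSup₂_of_le (f := fun (α : Weight K H L)
          (_ : ∃ m : ℕ, m ≠ 0 ∧ α y = -(2 * m)) => (rootSpace H α).toSubmodule)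
          α ⟨m, hm, h⟩ le_rfl).trans le_sup_right
    · have h0 : (α : H → K) = 0 := not_not.1 hα
      intro x hx
      rw [LieSubmodule.mem_toSubmodule, h0, rootSpace_zero_eq] at hx
      exact Submodule.mem_sup_left (Submodule.mem_sup_left hx)
  let P : Submodule K V := Submodule.span K {v} ⊔
    ⨆ (m : ℕ) (_ : m ≠ 0), (toEnd K L V (y : L)).eigenspace (2 * n - 2 * m)
  have hmemP : ∀ (m : ℕ), m ≠ 0 → ∀ w : V, ⁅(y : L), w⁆ = (2 * n - 2 * m : K) • w → w ∈ P :=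
    fun m hm w hw => Submodule.mem_sup_right (Submodule.mem_iSup_of_mem m
      (Submodule.mem_iSup_of_mem hm (Module.End.mem_eigenspace_iff.2 hw)))
  have hshift : ∀ (x : L) (w : V) (c d : K), ⁅(y : L), x⁆ = c • x → ⁅(y : L), w⁆ = d • w →
      ⁅(y : L), ⁅x, w⁆⁆ = (d + c) • ⁅x, w⁆ := by
    intro x w c d hx hw
    rw [leibniz_lie, hx, hw, smul_lie, lie_smul, add_smul, add_comm]
  have hProot : ∀ α : Weight K H L, ∀ m : ℕ, m ≠ 0 → α y = -(2 * m) → ∀ x ∈ rootSpace H α,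
      ∀ w ∈ P, ⁅x, w⁆ ∈ P := by
    intro α m hm hα x hx w hw
    have hyx : ⁅(y : L), x⁆ = (-(2 * m) : K) • x := by
      have := IsKilling.lie_eq_smul_of_mem_rootSpace hx y
      rw [hα] at this
      exact this
    obtain ⟨p, hp, q, hq, rfl⟩ := Submodule.mem_sup.1 hw
    rw [lie_add]
    refine P.add_mem ?_ ?_
    · obtain ⟨s, rfl⟩ := Submodule.mem_span_singleton.1 hp
      rw [lie_smul]
      refine P.smul_mem _ (hmemP m hm _ ?_)
      rw [hshift x v _ _ hyx hyv, sub_eq_add_neg]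
    · induction hq using Submodule.iSup_induction' with
      | mem m' q hq =>
        induction hq using Submodule.iSup_induction' with
        | mem hm' q hq =>
          refine hmemP (m' + m) (by omega) _ ?_
          rw [hshift x q _ _ hyx (Module.End.mem_eigenspace_iff.1 hq)]
          congr 1
          push_cast
          ring
        | zero => rw [lie_zero]; exact P.zero_mem
        | add a b _ _ ha hb =>
          rw [lie_add]
          exact P.add_mem (ha (P.add_mem (Submodule.mem_sup_left hp) (Submodule.mem_sup_right
            (Submodule.mem_iSup_of_mem m' ‹_›)))) (hb (P.add_mem (Submodule.mem_sup_left hp)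
            (Submodule.mem_sup_right (Submodule.mem_iSup_of_mem m' ‹_›))))
      | zero => rw [lie_zero]; exact P.zero_mem
      | add a b _ _ ha hb =>
        rw [lie_add]
        exact P.add_mem (ha (P.add_mem (Submodule.mem_sup_left hp) (Submodule.mem_sup_right ‹_›)))
          (hb (P.add_mem (Submodule.mem_sup_left hp) (Submodule.mem_sup_right ‹_›)))
  have hPtop : P = ⊤ := by
    have hbv : ∀ x ∈ b, (toEnd K L V : L →ₗ[K] Module.End K V) x v ∈ Submodule.span K {v} := by
      intro x hx
      change ⁅x, v⁆ ∈ _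
      obtain ⟨p, hp, q, hq, rfl⟩ := Submodule.mem_sup.1 hx
      rw [add_lie]
      refine Submodule.add_mem _ ?_ ?_
      · have : ⁅p, v⁆ = χ ⟨p, hp⟩ • v := (mem_weightSpace _ _).1 hvχ ⟨p, hp⟩
        rw [this]
        exact Submodule.smul_mem _ _ (Submodule.mem_span_singleton_self v)
      · have hq0 : ⁅q, v⁆ = 0 := by
          clear hx
          induction hq using Submodule.iSup_induction' with
          | mem α x hx =>
            induction hx using Submodule.iSup_induction' with
            | mem hα x hx => obtain ⟨m, hm, hα⟩ := hα; exact hpos α m hm hα x hx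
            | zero => rw [zero_lie]
            | add p q _ _ hp hq => rw [add_lie, hp, hq, add_zero]
          | zero => rw [zero_lie]
          | add p q _ _ hp hq => rw [add_lie, hp, hq, add_zero]
        rw [hq0]
        exact Submodule.zero_mem _
    have hnP : ∀ z ∈ nn, ∀ w ∈ P, (toEnd K L V : L →ₗ[K] Module.End K V) z w ∈ P := by
      intro z hz w hw
      change ⁅z, w⁆ ∈ P
      induction hz using Submodule.iSup_induction' with
      | mem α x hx =>
        induction hx using Submodule.iSup_induction' with
        | mem hα x hx => obtain ⟨m, hm, hα⟩ := hα; exact hProot α m hm hα x hx w hw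
        | zero => rw [zero_lie]; exact P.zero_mem
        | add p q _ _ hp hq => rw [add_lie]; exact P.add_mem hp hq
      | zero => rw [zero_lie]; exact P.zero_mem
      | add p q _ _ hp hq => rw [add_lie]; exact P.add_mem hp hq
    obtain ⟨N, hNP, hvN, hN⟩ := exists_stable_of_generator (K := K)
      (toEnd K L V : L →ₗ[K] Module.End K V) (fun x z m => lie_lie x z m) b nn hbn v hbv P
      (Submodule.mem_sup_left (Submodule.mem_span_singleton_self v)) hnP
    exact top_le_iff.1 (hgen N hN v hvN hv0 ▸ hNP)
  have hωu : ∀ w, ω w u = 0 := by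
    intro w
    obtain ⟨p, hp, q, hq, rfl⟩ := Submodule.mem_sup.1 (hPtop ▸ Submodule.mem_top : w ∈ P)
    obtain ⟨s, rfl⟩ := Submodule.mem_span_singleton.1 hp
    have hq0 : ω q u = 0 := by
      induction hq using Submodule.iSup_induction' with
      | mem m q hq =>
        induction hq using Submodule.iSup_induction' with
        | mem hm q hq =>
          have h1 := hinv (y : L) q u
          have h2 : ⁅(y : L), q⁆ = (2 * n - 2 * m : K) • q := Module.End.mem_eigenspace_iff.1 hq
          rw [h2, hyu, map_smul, map_smul, LinearMap.smul_apply, smul_eq_mul, smul_eq_mul,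
            ← add_mul] at h1
          refine (mul_eq_zero.1 h1).resolve_left ?_
          rw [show (2 * n - 2 * m + -(2 * n) : K) = -(2 * m) by ring]
          simpa using hm
        | zero => simp
        | add a b _ _ ha hb => simp [ha, hb]
      | zero => simp
      | add a b _ _ ha hb => simp [ha, hb]
    simp [hωvu, hq0]
  have hrad := hgen (LinearMap.ker ω.flip) (fun x m hm => by
    rw [LinearMap.mem_ker] at hm ⊢
    ext w
    have h1 := hinv x w m
    have h2 : ω ⁅x, w⁆ m = 0 := congrArg (fun ψ => ψ ⁅x, w⁆) hm
    rw [h2, zero_add] at h1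
    exact h1) u (by rw [LinearMap.mem_ker]; ext w; exact hωu w) hu0
  apply hne
  ext a c
  have : c ∈ LinearMap.ker ω.flip := hrad ▸ Submodule.mem_top
  exact congrArg (fun ψ => ψ a) (LinearMap.mem_ker.1 this)

end Killing

section Cartan

open LieAlgebra LieModule

theorem isCartanSubalgebra_map {K r s : Type*} [Field K] [LieRing r] [LieAlgebra K r]
    [FiniteDimensional K r] [LieRing s] [LieAlgebra K s]
    (f : r →ₗ⁅K⁆ s) (hf : Function.Surjective f) (H : LieSubalgebra K r) [H.IsCartanSubalgebra] :
    (H.map f).IsCartanSubalgebra := by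
  constructor
  · let fH : H →ₗ⁅K⁆ H.map f :=
      { toFun := fun y => ⟨f y, ⟨y, y.2, rfl⟩⟩
        map_add' := fun a b => Subtype.ext (map_add f _ _)
        map_smul' := fun c a => Subtype.ext (map_smul f _ _)
        map_lie' := fun {a b} => Subtype.ext (LieHom.map_lie f _ _) }
    have hfH : Function.Surjective fH := by
      rintro ⟨_, y, hy, rfl⟩
      exact ⟨⟨y, hy⟩, rfl⟩
    exact hfH.lieAlgebra_isNilpotent
  · refine le_antisymm (fun x' hx' => ?_) (LieSubalgebra.le_normalizer _)
    obtain ⟨x, rfl⟩ := hf x'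
    rw [LieSubalgebra.mem_normalizer_iff] at hx'
    let N : LieSubmodule K H r :=
      { (H.map f).toSubmodule.comap (f : r →ₗ[K] s) with
        lie_mem := by
          intro y m hm
          change f ⁅(y : r), m⁆ ∈ H.map f
          rw [LieHom.map_lie]
          exact (H.map f).lie_mem ⟨y, y.2, rfl⟩ hm }
    have hHN : H.toLieSubmodule ≤ N := fun y hy => ⟨y, hy, rfl⟩
    let q := LieSubmodule.Quotient.mk' N
    have hq : Function.Surjective q := LieSubmodule.Quotient.surjective_mk' N
    have hker : ∀ z, q z = 0 ↔ z ∈ N := fun z => LieSubmodule.Quotient.mk_eq_zero N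
    have hP : posFittingComp K H (r ⧸ N) = ⊤ := by
      rw [eq_top_iff]
      refine le_trans ?_ (map_posFittingComp_le q)
      intro z _
      obtain ⟨w, rfl⟩ := hq z
      have hw : w ∈ genWeightSpace r (0 : H → K) ⊔ posFittingComp K H r := by
        rw [(isCompl_genWeightSpace_zero_posFittingComp K H r).sup_eq_top]; trivial
      obtain ⟨a, ha, b, hb, rfl⟩ := (LieSubmodule.mem_sup _ _ _).1 hw
      have ha' : q a = 0 := by
        rw [hker]
        refine hHN ?_
        have := rootSpace_zero_eq K r H
        rw [← this]
        exact ha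
      rw [map_add, ha', zero_add]
      exact LieSubmodule.mem_map_of_mem hb
    have h0 : genWeightSpace (r ⧸ N) (0 : H → K) = ⊥ := by
      have := (isCompl_genWeightSpace_zero_posFittingComp K H (r ⧸ N)).inf_eq_bot
      rwa [hP, inf_top_eq] at this
    have hx0 : q x ∈ genWeightSpace (r ⧸ N) (0 : H → K) := by
      refine weightSpace_le_genWeightSpace _ _ ((mem_weightSpace _ _).2 fun y => ?_)
      rw [Pi.zero_apply, zero_smul, ← LieModuleHom.map_lie, hker]
      change f ⁅(y : r), x⁆ ∈ H.map f
      rw [← lie_skew, map_neg, LieHom.map_lie]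
      exact neg_mem (hx' _ ⟨y, y.2, rfl⟩)
    rw [h0, LieSubmodule.mem_bot, hker] at hx0
    exact hx0

theorem isKilling_of_irreducible_of_form {K L V : Type*} [Field K] [IsAlgClosed K] [CharZero K]
    [LieRing L] [LieAlgebra K L] [FiniteDimensional K L]
    [AddCommGroup V] [Module K V] [FiniteDimensional K V] [LieRingModule L V] [LieModule K L V]
    [LieModule.IsIrreducible K L V] [LieModule.IsFaithful K L V]
    (ω : V →ₗ[K] V →ₗ[K] K) (hinv : ∀ (x : L) v w, ω ⁅x, v⁆ w + ω v ⁅x, w⁆ = 0)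
    (hne : ω ≠ 0) : LieAlgebra.IsKilling K L := by
  obtain ⟨h1, h2⟩ := hasCentralRadical_and_of_isIrreducible_of_isFaithful K L V
  have hc : center K L = ⊥ := by
    rw [eq_bot_iff]
    intro x hx
    obtain ⟨t, ht⟩ := Submodule.mem_span_singleton.1 ((h2 x).1 hx)
    have hx' : ∀ v : V, ⁅x, v⁆ = t • v := fun v => (congrArg (fun φ => φ v) ht).symm
    have ht0 : t = 0 := by
      by_contra ht0
      apply hne
      ext v w
      have := hinv x v w
      rw [hx', hx', map_smul, map_smul, LinearMap.smul_apply, ← two_smul K, smul_smul,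
        smul_eq_zero] at this
      simpa [ht0] using this
    rw [LieSubmodule.mem_bot]
    refine (LieModule.isFaithful_iff' K L V).1 inferInstance x fun v => ?_
    rw [hx', ht0, zero_smul]
  have : HasTrivialRadical K L := ⟨h1.radical_eq_center.trans hc⟩
  infer_instance

end Cartan

section Symplectic

open LieAlgebra LieModule

attribute [local instance] LieRing.ofAssociativeRing

theorem iSup_eigenspace_toEnd_eq_top {K L V : Type*} [Field K] [IsAlgClosed K] [CharZero K]
    [LieRing L] [LieAlgebra K L] [FiniteDimensional K L] [LieAlgebra.IsKilling K L]
    (H : LieSubalgebra K L) [H.IsCartanSubalgebra]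
    [AddCommGroup V] [Module K V] [FiniteDimensional K V] [LieRingModule L V] [LieModule K L V]
    [LieModule.IsIrreducible K L V] (y : H) :
    ⨆ μ : K, (toEnd K L V (y : L)).eigenspace μ = ⊤ := by
  rw [eq_top_iff, ← iSup_weightSpace_eq_top (V := V) H]
  exact iSup_le fun χ v hv => Submodule.mem_iSup_of_mem (χ y)
    (Module.End.mem_eigenspace_iff.2 ((mem_weightSpace _ _).1 hv y))

theorem apply_eq_smul_of_pow_apply_eq_zero {K V : Type*} [Field K] [AddCommGroup V] [Module K V]
    (f : Module.End K V) (hf : ⨆ μ : K, f.eigenspace μ = ⊤) (μ : K) (k : ℕ) (v : V)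
    (hv : ((f - μ • 1) ^ k) v = 0) : f v = μ • v := by
  have h1 : iSupIndep f.maxGenEigenspace := f.independent_maxGenEigenspace
  have h2 := (h1.le_iff_eq_of_iSup_eq_top hf).1
    fun μ => (Module.End.genEigenspace f μ).monotone le_top
  have h3 : v ∈ f.maxGenEigenspace μ :=
    (Module.End.mem_maxGenEigenspace f μ v).2 ⟨k, hv⟩
  rw [← congrFun h2 μ] at h3
  exact Module.End.mem_eigenspace_iff.1 h3

variable {K r V : Type*} [Field K] [IsAlgClosed K] [CharZero K]
  [LieRing r] [LieAlgebra K r] [FiniteDimensional K r]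
  [AddCommGroup V] [Module K V] [FiniteDimensional K V] [LieRingModule r V] [LieModule K r V]
  [LieModule.IsIrreducible K r V]

theorem isIrreducible_range_toEnd : LieModule.IsIrreducible K (toEnd K r V).range V := by
  have : Nontrivial V := LieModule.nontrivial_of_isIrreducible K r V
  refine LieModule.IsIrreducible.mk fun N hN => ?_
  let N' : LieSubmodule K r V :=
    { N with lie_mem := fun {x m} hm => N.lie_mem (x := ⟨toEnd K r V x, ⟨x, rfl⟩⟩) hm }
  have hN' : N' ≠ ⊥ := by
    intro h0
    apply hN
    have h1 : (N' : Submodule K V) = ⊥ := by rw [h0]; rfl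
    exact LieSubmodule.toSubmodule_injective h1
  have h2 : (N' : Submodule K V) = ⊤ :=
    congrArg LieSubmodule.toSubmodule ((eq_bot_or_eq_top N').resolve_left hN')
  exact LieSubmodule.toSubmodule_injective h2

variable (ω : V →ₗ[K] V →ₗ[K] K) (hinv : ∀ (x : r) v w, ω ⁅x, v⁆ w + ω v ⁅x, w⁆ = 0)
  (hne : ω ≠ 0)

include hinv hne

theorem isKilling_range_toEnd : LieAlgebra.IsKilling K (toEnd K r V).range := by
  have := isIrreducible_range_toEnd (K := K) (r := r) (V := V)
  refine isKilling_of_irreducible_of_form (V := V) ω ?_ hne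
  rintro ⟨_, x, rfl⟩ v w
  exact hinv x v w

theorem lie_eq_zero_of_mem_radical {x : r} (hx : x ∈ radical K r) (v : V) : ⁅x, v⁆ = 0 := by
  have := isKilling_range_toEnd ω hinv hne
  have hrad : radical K (toEnd K r V).range = ⊥ := HasTrivialRadical.radical_eq_bot
  have h1 : (radical K r).map (toEnd K r V).rangeRestrict ≤ radical K (toEnd K r V).range := by
    have hs : IsSolvable ((radical K r).map (toEnd K r V).rangeRestrict) := by
      have hsurj := LieHom.surjective_rangeRestrict (toEnd K r V)
      let f : radical K r →ₗ⁅K⁆ (radical K r).map (toEnd K r V).rangeRestrict :=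
        { toFun := fun x => ⟨(toEnd K r V).rangeRestrict x, LieIdeal.mem_map x.2⟩
          map_add' := fun x y => by ext1; simp
          map_smul' := fun t x => by ext1; simp
          map_lie' := fun {x y} => by ext1; simp }
      have hf : Function.Surjective f := by
        rintro ⟨y, hy⟩
        obtain ⟨x, hx⟩ := LieIdeal.mem_map_of_surjective hsurj hy
        exact ⟨x, Subtype.ext hx⟩
      exact hf.lieAlgebra_isSolvable
    exact (LieIdeal.solvable_iff_le_radical K _ _).1 hs
  have h2 : (toEnd K r V).rangeRestrict x ∈ (radical K r).map (toEnd K r V).rangeRestrict :=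
    LieIdeal.mem_map hx
  have h3 := h1 h2
  rw [hrad, LieSubmodule.mem_bot] at h3
  exact congrArg (fun φ : (toEnd K r V).range => (φ : Module.End K V) v) h3

variable (c : LieSubalgebra K r) [c.IsCartanSubalgebra]

theorem lie_eq_smul_of_pow_of_form {y : r} (hy : y ∈ c) {μ : K} {k : ℕ} {v : V}
    (hv : ((toEnd K r V y - μ • 1) ^ k) v = 0) : ⁅y, v⁆ = μ • v := by
  have := isKilling_range_toEnd ω hinv hne
  have := isIrreducible_range_toEnd (K := K) (r := r) (V := V)
  have := isCartanSubalgebra_map (toEnd K r V).rangeRestrict (LieHom.surjective_rangeRestrict _) c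
  exact apply_eq_smul_of_pow_apply_eq_zero (toEnd K r V y)
    (iSup_eigenspace_toEnd_eq_top (V := V) (c.map (toEnd K r V).rangeRestrict)
      ⟨_, ⟨y, hy, rfl⟩⟩) μ k v hv

theorem eq_zero_of_forall_lie_eq_zero_of_form (halt : ∀ v, ω v v = 0) {v : V}
    (hv : ∀ y ∈ c, ⁅y, v⁆ = 0) : v = 0 := by
  have := isKilling_range_toEnd ω hinv hne
  have := isIrreducible_range_toEnd (K := K) (r := r) (V := V)
  have := isCartanSubalgebra_map (toEnd K r V).rangeRestrict (LieHom.surjective_rangeRestrict _) c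
  refine eq_zero_of_forall_lie_eq_zero_of_alternating
    (c.map (toEnd K r V).rangeRestrict) ω halt ?_ hne v ?_
  · rintro ⟨_, x, rfl⟩ v w
    exact hinv x v w
  · rintro ⟨_, y, hy, rfl⟩
    exact hv y hy

end Symplectic

section MinimalIdeal

open LieAlgebra LieModule

variable {K r : Type*} [Field K] [LieRing r] [LieAlgebra K r]

/-- `A` is minimal among the ideals of `r` that are not central. -/
def IsMinNoncentral (A : LieIdeal K r) : Prop :=
  ¬A ≤ center K r ∧ ∀ I : LieIdeal K r, I < A → I ≤ center K r

theorem mem_center_iff {z : r} : z ∈ center K r ↔ ∀ x : r, ⁅x, z⁆ = 0 :=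
  mem_maxTrivSubmodule (R := K) (L := r) (M := r) z

theorem lie_eq_zero_of_mem_center {z : r} (hz : z ∈ center K r) (x : r) : ⁅z, x⁆ = 0 := by
  rw [← lie_skew, mem_center_iff.1 hz x, neg_zero]

theorem exists_isMinNoncentral_le [FiniteDimensional K r] {B : LieIdeal K r}
    (hB : ¬B ≤ center K r) : ∃ A ≤ B, IsMinNoncentral A := by
  obtain ⟨A, ⟨hAB, hA⟩, hmin⟩ := WellFounded.has_min
    (LieSubmodule.wellFoundedLT_of_isArtinian K r r).wf
    {A | A ≤ B ∧ ¬A ≤ center K r} ⟨B, le_rfl, hB⟩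
  refine ⟨A, hAB, hA, fun I hI => ?_⟩
  by_contra h
  exact hmin I ⟨hI.le.trans hAB, h⟩ hI

namespace IsMinNoncentral

variable {A : LieIdeal K r} (hA : IsMinNoncentral A)

/-- The subideal of central elements of `A`. -/
abbrev centralPart (A : LieIdeal K r) : LieSubmodule K r A :=
  LieSubmodule.comap (LieSubmodule.incl A) (center K r)

include hA

theorem isIrreducible : LieModule.IsIrreducible K r (A ⧸ centralPart A) := by
  have hq := LieSubmodule.Quotient.surjective_mk' (centralPart A)
  have hmem : ∀ a : A, LieSubmodule.Quotient.mk' (centralPart A) a = 0 ↔ (a : r) ∈ center K r :=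
    fun a => LieSubmodule.Quotient.mk_eq_zero (centralPart A)
  have hnt : Nontrivial (A ⧸ centralPart A) := by
    by_contra h
    rw [not_nontrivial_iff_subsingleton] at h
    exact hA.1 fun a ha => (hmem ⟨a, ha⟩).1 (Subsingleton.elim _ _)
  refine LieModule.IsIrreducible.mk fun N hN => ?_
  let N' : LieIdeal K r := LieSubmodule.map (LieSubmodule.incl A)
    (N.comap (LieSubmodule.Quotient.mk' (centralPart A)))
  have hN' : N' ≤ A := by
    rintro _ ⟨a, -, rfl⟩
    exact a.2
  rcases hN'.lt_or_eq with h | h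
  · refine absurd ?_ hN
    rw [eq_bot_iff]
    intro v hv
    obtain ⟨a, rfl⟩ := hq v
    have : (a : r) ∈ N' := ⟨a, hv, rfl⟩
    rw [LieSubmodule.mem_bot]
    exact (hmem a).2 (hA.2 N' h this)
  · rw [eq_top_iff]
    intro v _
    obtain ⟨a, rfl⟩ := hq v
    have : (a : r) ∈ N' := by rw [h]; exact a.2
    obtain ⟨a', ha', h'⟩ := this
    have : a' = a := Subtype.ext h'
    exact this ▸ ha'

variable [FiniteDimensional K r] (hAR : A ≤ radical K r)

include hAR

theorem lie_mem_center {a a' : r} (ha : a ∈ A) (ha' : a' ∈ A) : ⁅a, a'⁆ ∈ center K r := by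
  have hle : ⁅A, A⁆ ≤ A := LieSubmodule.lie_le_right A A
  rcases hle.lt_or_eq with h | h
  · exact hA.2 _ h (LieSubmodule.lie_mem_lie ha ha')
  · exfalso
    have hs : IsSolvable A := (LieIdeal.solvable_iff_le_radical K r A).2 hAR
    obtain ⟨k, hk⟩ := (isSolvable_iff K A).1 hs
    rw [LieIdeal.derivedSeries_eq_bot_iff] at hk
    have : ∀ k, derivedSeriesOfIdeal K r k A = A := by
      intro k
      induction k with
      | zero => rfl
      | succ k ih => rw [derivedSeriesOfIdeal_succ, ih, h]
    rw [this] at hk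
    exact hA.1 (hk ▸ bot_le)

theorem exists_form (hred : ∀ I : LieIdeal K r, IsLieAbelian I → I ≤ center K r) :
    ∃ ω : (A ⧸ centralPart A) →ₗ[K] (A ⧸ centralPart A) →ₗ[K] K,
      (∀ (x : r) v w, ω ⁅x, v⁆ w + ω v ⁅x, w⁆ = 0) ∧ ω ≠ 0 ∧ ∀ v, ω v v = 0 := by
  have hex : ∃ a ∈ A, ∃ a' ∈ A, ⁅a, a'⁆ ≠ 0 := by
    by_contra! h
    refine hA.1 (hred A ?_)
    constructor
    rintro ⟨a, ha⟩ ⟨a', ha'⟩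
    exact Subtype.ext (h a ha a' ha')
  obtain ⟨a₀, ha₀, a₁, ha₁, hne⟩ := hex
  obtain ⟨φ, hφ⟩ : ∃ φ : Module.Dual K r, φ ⁅a₀, a₁⁆ ≠ 0 := by
    by_contra! h
    exact hne ((Module.forall_dual_apply_eq_zero_iff K _).1 h)
  let β : A →ₗ[K] A →ₗ[K] K :=
    LinearMap.mk₂ K (fun a a' => φ ⁅(a : r), (a' : r)⁆)
      (by intros; simp) (by intros; simp) (by intros; simp) (by intros; simp)
  have h1 : (centralPart A).toSubmodule ≤ β.ker := by
    intro a ha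
    ext a'
    change φ ⁅(a : r), (a' : r)⁆ = 0
    rw [lie_eq_zero_of_mem_center (show (a : r) ∈ center K r from ha), map_zero]
  have h2 : (centralPart A).toSubmodule ≤ β.flip.ker := by
    intro a ha
    ext a'
    change φ ⁅(a' : r), (a : r)⁆ = 0
    rw [mem_center_iff.1 (show (a : r) ∈ center K r from ha), map_zero]
  have hq := LieSubmodule.Quotient.surjective_mk' (centralPart A)
  let ω : (A ⧸ centralPart A) →ₗ[K] (A ⧸ centralPart A) →ₗ[K] K := β.liftQ₂ _ _ h1 h2
  have hω : ∀ a a' : A, ω (LieSubmodule.Quotient.mk' (centralPart A) a)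
      (LieSubmodule.Quotient.mk' (centralPart A) a') = φ ⁅(a : r), (a' : r)⁆ := fun _ _ => rfl
  refine ⟨ω, ?_, ?_, ?_⟩
  · intro x v w
    obtain ⟨a, rfl⟩ := hq v
    obtain ⟨a', rfl⟩ := hq w
    rw [← LieModuleHom.map_lie, ← LieModuleHom.map_lie, hω, hω, ← map_add]
    have := mem_center_iff.1 (hA.lie_mem_center hAR a.2 a'.2) x
    rw [leibniz_lie] at this
    simpa using congrArg φ this
  · intro h0
    have := hω ⟨a₀, ha₀⟩ ⟨a₁, ha₁⟩
    rw [h0] at this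
    exact hφ this.symm
  · intro v
    obtain ⟨a, rfl⟩ := hq v
    rw [hω, lie_self, map_zero]

variable [IsAlgClosed K] [CharZero K]
  (hred : ∀ I : LieIdeal K r, IsLieAbelian I → I ≤ center K r)

include hred

theorem lie_mem_center_of_mem_radical {x a : r} (hx : x ∈ radical K r) (ha : a ∈ A) :
    ⁅x, a⁆ ∈ center K r := by
  have := hA.isIrreducible
  obtain ⟨ω, hinv, hne, -⟩ := hA.exists_form hAR hred
  have h := lie_eq_zero_of_mem_radical ω hinv hne hx
    (LieSubmodule.Quotient.mk' (centralPart A) ⟨a, ha⟩)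
  rw [← LieModuleHom.map_lie] at h
  exact (LieSubmodule.Quotient.mk_eq_zero (centralPart A)).1 h

variable (c : LieSubalgebra K r) [c.IsCartanSubalgebra]

theorem lie_sub_smul_mem_center {y a : r} (hy : y ∈ c) (ha : a ∈ A) {μ : K} {k : ℕ}
    (h : ((ad K r y - μ • 1) ^ k) a = 0) : ⁅y, a⁆ - μ • a ∈ center K r := by
  have := hA.isIrreducible
  obtain ⟨ω, hinv, hne, -⟩ := hA.exists_form hAR hred
  let q := LieSubmodule.Quotient.mk' (centralPart A)
  have key : ∀ (k : ℕ) (a : r) (ha : a ∈ A), ∃ ha' : ((ad K r y - μ • 1) ^ k) a ∈ A,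
      q ⟨_, ha'⟩ = ((toEnd K r (A ⧸ centralPart A) y - μ • 1) ^ k) (q ⟨a, ha⟩) := by
    intro k
    induction k with
    | zero => exact fun a ha => ⟨ha, rfl⟩
    | succ k ih =>
      intro a ha
      have h1 : (ad K r y - μ • 1) a ∈ A := A.sub_mem (A.lie_mem ha) (A.smul_mem μ ha)
      obtain ⟨h2, h3⟩ := ih _ h1
      rw [pow_succ, pow_succ]
      refine ⟨h2, h3.trans ?_⟩
      rw [Module.End.mul_apply]
      congr 1
  obtain ⟨ha', h'⟩ := key k a ha
  have h0 : ((toEnd K r (A ⧸ centralPart A) y - μ • 1) ^ k) (q ⟨a, ha⟩) = 0 := by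
    rw [← h', ← map_zero q]
    exact congrArg q (Subtype.ext h)
  have h4 := lie_eq_smul_of_pow_of_form ω hinv hne c hy h0
  rw [← sub_eq_zero] at h4
  exact (LieSubmodule.Quotient.mk_eq_zero (centralPart A) (m := ⁅y, ⟨a, ha⟩⁆ - μ • ⟨a, ha⟩)).1 h4

theorem mem_center_of_forall_lie_mem_center {a : r} (ha : a ∈ A)
    (h : ∀ y ∈ c, ⁅y, a⁆ ∈ center K r) : a ∈ center K r := by
  have := hA.isIrreducible
  obtain ⟨ω, hinv, hne, halt⟩ := hA.exists_form hAR hred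
  let q := LieSubmodule.Quotient.mk' (centralPart A)
  have h0 : q ⟨a, ha⟩ = 0 := by
    refine eq_zero_of_forall_lie_eq_zero_of_form ω hinv hne c halt fun y hy => ?_
    exact (LieSubmodule.Quotient.mk_eq_zero (centralPart A) (m := ⁅y, ⟨a, ha⟩⁆)).2 (h y hy)
  exact (LieSubmodule.Quotient.mk_eq_zero (centralPart A)).1 h0

end IsMinNoncentral

end MinimalIdeal

section Reductive

open LieAlgebra LieModule

variable {K r : Type*} [Field K] [LieRing r] [LieAlgebra K r] [FiniteDimensional K r]

/-- The projection of a Lie algebra onto the quotient by an ideal. -/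
def LieIdeal.quotientHom (I : LieIdeal K r) : r →ₗ⁅K⁆ r ⧸ I :=
  { (LieSubmodule.Quotient.mk' I : r →ₗ[K] r ⧸ I) with
    map_lie' := fun {x y} => LieSubmodule.Quotient.mk_bracket _ x y }

theorem LieIdeal.quotientHom_surjective (I : LieIdeal K r) :
    Function.Surjective I.quotientHom :=
  LieSubmodule.Quotient.surjective_mk' I

theorem LieIdeal.quotientHom_eq_zero_iff (I : LieIdeal K r) (x : r) :
    I.quotientHom x = 0 ↔ x ∈ I :=
  LieSubmodule.Quotient.mk_eq_zero I

theorem LieAlgebra.hasTrivialRadical_quotient_radical :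
    HasTrivialRadical K (r ⧸ radical K r) := by
  refine hasTrivialRadical_of_no_solvable_ideals fun J hJ => ?_
  have hf := (radical K r).quotientHom_surjective
  obtain ⟨k, hk⟩ := (isSolvable_iff K J).1 hJ
  obtain ⟨l, hl⟩ := (isSolvable_iff K (radical K r)).1 inferInstance
  rw [LieIdeal.derivedSeries_eq_bot_iff] at hk hl
  let I := J.comap (radical K r).quotientHom
  have h1 : ∀ k, ∀ x ∈ derivedSeriesOfIdeal K r k I,
      (radical K r).quotientHom x ∈ derivedSeriesOfIdeal K (r ⧸ radical K r) k J := by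
    intro k
    suffices h : derivedSeriesOfIdeal K r k I ≤
        (derivedSeriesOfIdeal K (r ⧸ radical K r) k J).comap (radical K r).quotientHom from
      fun x hx => h hx
    induction k with
    | zero => exact le_rfl
    | succ k ih =>
      rw [derivedSeriesOfIdeal_succ, derivedSeriesOfIdeal_succ, LieSubmodule.lie_le_iff]
      intro x hx m hm
      rw [LieIdeal.mem_comap, LieHom.map_lie]
      exact LieSubmodule.lie_mem_lie (ih hx) (ih hm)
  have h2 : derivedSeriesOfIdeal K r k I ≤ radical K r := by
    intro x hx
    have := h1 k x hx
    rwa [hk, LieSubmodule.mem_bot, LieIdeal.quotientHom_eq_zero_iff] at this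
  have h3 : derivedSeriesOfIdeal K r (l + k) I = ⊥ := by
    rw [derivedSeriesOfIdeal_add, eq_bot_iff, ← hl]
    exact derivedSeriesOfIdeal_mono h2 l
  have h4 : I ≤ radical K r := by
    refine (LieIdeal.solvable_iff_le_radical K r I).1 ((isSolvable_iff K I).2 ⟨l + k, ?_⟩)
    rwa [LieIdeal.derivedSeries_eq_bot_iff]
  rw [eq_bot_iff]
  intro y hy
  obtain ⟨x, rfl⟩ := hf y
  rw [LieSubmodule.mem_bot, LieIdeal.quotientHom_eq_zero_iff]
  exact h4 hy

theorem LieAlgebra.derivedSeries_one_eq_top_of_isKilling {s : Type*} [LieRing s] [LieAlgebra K s]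
    [FiniteDimensional K s] [IsSemisimple K s] : derivedSeries K s 1 = ⊤ := by
  obtain ⟨J, hJ⟩ := exists_isCompl (derivedSeries K s 1)
  have hab : IsLieAbelian J := by
    constructor
    rintro ⟨a, ha⟩ ⟨b, hb⟩
    refine Subtype.ext ?_
    have h1 : ⁅a, b⁆ ∈ derivedSeries K s 1 :=
      LieSubmodule.lie_mem_lie (I := ⊤) (N := ⊤) trivial trivial
    have h2 : ⁅a, b⁆ ∈ J := J.lie_mem hb
    have := hJ.disjoint.le_bot ⟨h1, h2⟩
    simpa using this
  have hJ0 : J = ⊥ := HasTrivialRadical.eq_bot_of_isSolvable J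
  have := hJ.sup_eq_top
  rwa [hJ0, sup_bot_eq] at this

variable [IsAlgClosed K] [CharZero K] (c : LieSubalgebra K r) [c.IsCartanSubalgebra]

theorem eq_zero_of_mem_center_of_mem_rootSpace {χ : c → K} (hχ : χ ≠ 0) {z : r}
    (hz : z ∈ center K r) (hzχ : z ∈ rootSpace c χ) : z = 0 := by
  have h0 : z ∈ rootSpace c (0 : c → K) := by
    rw [mem_genWeightSpace]
    refine fun y => ⟨1, ?_⟩
    have : ⁅(y : r), z⁆ = 0 := mem_center_iff.1 hz y
    simpa using this
  have := (disjoint_genWeightSpace K c r hχ).le_bot ⟨hzχ, h0⟩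
  simpa using this

theorem LieIdeal.rootSpace_induction (I : LieIdeal K r) {p : r → Prop}
    (hp : ∀ χ : c → K, ∀ a ∈ I, a ∈ rootSpace c χ → p a) (h0 : p 0)
    (hadd : ∀ a b, p a → p b → p (a + b)) {a : r} (ha : a ∈ I) : p a := by
  have h1 : a ∈ ⨆ χ : Weight K c r, I.restr c ⊓ genWeightSpace r χ := by
    rw [← eq_iSup_inf_genWeightSpace (N := I.restr c)]
    exact ha
  rw [← LieSubmodule.mem_toSubmodule, LieSubmodule.iSup_toSubmodule] at h1
  refine Submodule.iSup_induction _ (motive := p) h1 ?_ h0 hadd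
  rintro χ x ⟨hx1, hx2⟩
  exact hp χ x hx1 hx2

variable (hred : ∀ I : LieIdeal K r, IsLieAbelian I → I ≤ center K r)
include hred

theorem mem_center_of_forall_isMinNoncentral {x : r} (hx : x ∈ radical K r)
    (h : ∀ A : LieIdeal K r, IsMinNoncentral A → A ≤ radical K r → ∀ a ∈ A, ⁅x, a⁆ = 0) :
    x ∈ center K r := by
  let D : LieIdeal K r :=
    { carrier := {x | x ∈ radical K r ∧
        ∀ A : LieIdeal K r, IsMinNoncentral A → A ≤ radical K r → ∀ a ∈ A, ⁅x, a⁆ = 0}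
      zero_mem' := ⟨zero_mem _, fun _ _ _ _ _ => zero_lie _⟩
      add_mem' := fun {x y} hx hy => ⟨add_mem hx.1 hy.1, fun A hA hAR a ha => by
        rw [add_lie, hx.2 A hA hAR a ha, hy.2 A hA hAR a ha, add_zero]⟩
      smul_mem' := fun t x hx => ⟨(radical K r).smul_mem t hx.1, fun A hA hAR a ha => by
        rw [smul_lie, hx.2 A hA hAR a ha, smul_zero]⟩
      lie_mem := fun {x y} hy => ⟨(radical K r).lie_mem hy.1, fun A hA hAR a ha => by
        rw [lie_lie, hy.2 A hA hAR a ha, hy.2 A hA hAR _ (A.lie_mem ha), lie_zero, sub_zero]⟩ }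
  by_contra hxc
  have hD : ¬D ≤ center K r := fun hle => hxc (hle ⟨hx, h⟩)
  obtain ⟨A, hAD, hA⟩ := exists_isMinNoncentral_le hD
  have hAR : A ≤ radical K r := fun a ha => (hAD ha).1
  refine hA.1 (hred A ⟨?_⟩)
  rintro ⟨a, ha⟩ ⟨a', ha'⟩
  exact Subtype.ext ((hAD ha).2 A hA hAR a' ha')

namespace IsMinNoncentral

variable {A : LieIdeal K r} (hA : IsMinNoncentral A) (hAR : A ≤ radical K r)
include hA hAR

theorem lie_sub_smul_mem_center_of_mem_rootSpace {a : r} (ha : a ∈ A) {χ : c → K}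
    (hχ : a ∈ rootSpace c χ) (y : c) : ⁅(y : r), a⁆ - χ y • a ∈ center K r := by
  obtain ⟨k, hk⟩ := (mem_genWeightSpace r χ a).1 hχ y
  exact hA.lie_sub_smul_mem_center hAR hred c y.2 ha hk

theorem mem_center_of_mem_rootSpace_zero {a : r} (ha : a ∈ A)
    (h0 : a ∈ rootSpace c (0 : c → K)) : a ∈ center K r := by
  refine hA.mem_center_of_forall_lie_mem_center hAR hred c ha fun y hy => ?_
  simpa using hA.lie_sub_smul_mem_center_of_mem_rootSpace c hred hAR ha h0 ⟨y, hy⟩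

theorem lie_eq_smul_of_mem_rootSpace {a : r} (ha : a ∈ A) {χ : c → K}
    (hχ : a ∈ rootSpace c χ) (y : c) : ⁅(y : r), a⁆ = χ y • a := by
  by_cases h0 : χ = 0
  · subst h0
    rw [mem_center_iff.1 (hA.mem_center_of_mem_rootSpace_zero c hred hAR ha hχ)]
    simp
  · rw [← sub_eq_zero]
    refine eq_zero_of_mem_center_of_mem_rootSpace c h0
      (hA.lie_sub_smul_mem_center_of_mem_rootSpace c hred hAR ha hχ y) ?_
    exact (rootSpace c χ).sub_mem ((rootSpace c χ).lie_mem hχ) ((rootSpace c χ).smul_mem _ hχ)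

end IsMinNoncentral

theorem mem_center_of_mem_radical_of_mem_cartan {x : r} (hx : x ∈ radical K r) (hxc : x ∈ c) :
    x ∈ center K r := by
  refine mem_center_of_forall_isMinNoncentral hred hx fun A hA hAR a ha => ?_
  refine LieIdeal.rootSpace_induction c A (p := fun a => ⁅x, a⁆ = 0) (fun χ a ha hχ => ?_)
    (lie_zero x) (fun a b h1 h2 => by rw [lie_add, h1, h2, add_zero]) ha
  by_cases h0 : χ = 0
  · subst h0
    exact mem_center_iff.1 (hA.mem_center_of_mem_rootSpace_zero c hred hAR ha hχ) x
  · exact eq_zero_of_mem_center_of_mem_rootSpace c h0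
      (hA.lie_mem_center_of_mem_radical hAR hred hx ha) ((rootSpace c χ).lie_mem (x := ⟨x, hxc⟩) hχ)

theorem lie_sub_smul_mem_radical {χ : c → K} {u : r} (hu : u ∈ rootSpace c χ) (y : c) :
    ⁅(y : r), u⁆ - χ y • u ∈ radical K r := by
  have := hasTrivialRadical_quotient_radical (K := K) (r := r)
  let f := (radical K r).quotientHom
  have hf : Function.Surjective f := LieIdeal.quotientHom_surjective _
  have hc := isCartanSubalgebra_map f hf c
  obtain ⟨k, hk⟩ := (mem_genWeightSpace r χ u).1 hu y
  have key : ∀ (k : ℕ) (v : r), f (((ad K r (y : r) - χ y • 1) ^ k) v) =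
      ((ad K _ (f y) - χ y • 1) ^ k) (f v) := by
    intro k
    induction k with
    | zero => exact fun _ => rfl
    | succ k ih =>
      intro v
      rw [pow_succ, pow_succ, Module.End.mul_apply, Module.End.mul_apply, ih]
      congr 1
  have h0 : ((ad K _ (f y) - χ y • 1) ^ k) (f u) = 0 := by
    rw [← key, ← map_zero f]
    exact congrArg f hk
  have hdiag : ⨆ μ : K, (ad K _ (f y)).eigenspace μ = ⊤ := by
    rw [eq_top_iff, ← iSup_rootSpace_eq_top (c.map f)]
    refine iSup_le fun α v hv => Submodule.mem_iSup_of_mem (α ⟨f y, ⟨y, y.2, rfl⟩⟩)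
      (Module.End.mem_eigenspace_iff.2 ?_)
    exact IsKilling.lie_eq_smul_of_mem_rootSpace hv ⟨f y, ⟨y, y.2, rfl⟩⟩
  have h1 := apply_eq_smul_of_pow_apply_eq_zero _ hdiag _ k _ h0
  rw [← LieIdeal.quotientHom_eq_zero_iff]
  change f _ = 0
  rw [map_sub, LieHom.map_lie, map_smul, sub_eq_zero]
  exact h1

theorem lie_eq_smul_of_mem_rootSpace_of_ne_zero {χ : c → K} (hχ : χ ≠ 0) {u : r}
    (hu : u ∈ rootSpace c χ) (y : c) : ⁅(y : r), u⁆ = χ y • u := by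
  rw [← sub_eq_zero]
  refine eq_zero_of_mem_center_of_mem_rootSpace c hχ ?_
    ((rootSpace c χ).sub_mem ((rootSpace c χ).lie_mem hu) ((rootSpace c χ).smul_mem _ hu))
  refine mem_center_of_forall_isMinNoncentral hred
    (lie_sub_smul_mem_radical c hred hu y) fun A hA hAR a ha => ?_
  refine LieIdeal.rootSpace_induction c A (p := fun a => ⁅⁅(y : r), u⁆ - χ y • u, a⁆ = 0)
    (fun ψ a ha hψ => ?_) (lie_zero _) (fun a b h1 h2 => by rw [lie_add, h1, h2, add_zero]) ha
  have h1 : ⁅u, a⁆ ∈ rootSpace c (χ + ψ) := lie_mem_genWeightSpace_of_mem_genWeightSpace hu hψ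
  have h2 := hA.lie_eq_smul_of_mem_rootSpace c hred hAR (A.lie_mem ha) h1 y
  have h3 := hA.lie_eq_smul_of_mem_rootSpace c hred hAR ha hψ y
  rw [sub_lie, lie_lie, h2, h3, smul_lie, lie_smul, Pi.add_apply]
  module

/-- Cartan subalgebras of a reductive Lie algebra are abelian. -/
theorem lie_eq_zero_of_mem_cartan {x y : r} (hx : x ∈ c) (hy : y ∈ c) : ⁅x, y⁆ = 0 := by
  have := hasTrivialRadical_quotient_radical (K := K) (r := r)
  let f := (radical K r).quotientHom
  have hf : Function.Surjective f := LieIdeal.quotientHom_surjective _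
  have hc := isCartanSubalgebra_map f hf c
  have hcc : ∀ x ∈ c, ∀ y ∈ c, ⁅x, y⁆ ∈ center K r := by
    intro x hx y hy
    refine mem_center_of_mem_radical_of_mem_cartan c hred ?_ (c.lie_mem hx hy)
    rw [← LieIdeal.quotientHom_eq_zero_iff, LieHom.map_lie]
    have hab : IsLieAbelian (c.map f) := IsKilling.instIsLieAbelianOfIsCartanSubalgebra ..
    exact congrArg Subtype.val (hab.trivial ⟨f x, ⟨x, hx, rfl⟩⟩ ⟨f y, ⟨y, hy, rfl⟩⟩)
  have hroot : ∀ {χ : c → K}, χ ≠ 0 → ∀ u ∈ rootSpace c χ, ∀ y : c, ⁅(y : r), u⁆ = χ y • u :=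
    fun h u hu y => lie_eq_smul_of_mem_rootSpace_of_ne_zero c hred h hu y
  let Zc : Submodule K r :=
    { carrier := {x | x ∈ c ∧ ∀ y ∈ c, ⁅y, x⁆ = 0}
      zero_mem' := ⟨c.zero_mem, fun _ _ => lie_zero _⟩
      add_mem' := fun {a b} ha hb => ⟨c.add_mem ha.1 hb.1, fun y hy => by
        rw [lie_add, ha.2 y hy, hb.2 y hy, add_zero]⟩
      smul_mem' := fun t a ha => ⟨c.smul_mem t ha.1, fun y hy => by
        rw [lie_smul, ha.2 y hy, smul_zero]⟩ }
  let P : Submodule K r := ⨆ χ : {χ : c → K // χ ≠ 0}, (rootSpace c χ.1).toSubmodule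
  have hP : ∀ {χ : c → K}, χ ≠ 0 → ∀ u ∈ rootSpace c χ, u ∈ P := fun {χ} h u hu =>
    Submodule.mem_iSup_of_mem (p := fun χ : {χ : c → K // χ ≠ 0} => (rootSpace c χ.1).toSubmodule)
      ⟨χ, h⟩ hu
  have hc0 : ∀ {u : r}, u ∈ rootSpace c (0 : c → K) → u ∈ c := by
    intro u hu
    rwa [rootSpace_zero_eq] at hu
  have hc0' : ∀ {u : r}, u ∈ c → u ∈ rootSpace c (0 : c → K) := by
    intro u hu
    rwa [rootSpace_zero_eq]
  have hlie : ∀ x m : r, m ∈ Zc ⊔ P → ⁅x, m⁆ ∈ Zc ⊔ P := by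
    intro x m hm
    refine LieIdeal.rootSpace_induction c (⊤ : LieIdeal K r) (p := fun x => ⁅x, m⁆ ∈ Zc ⊔ P)
      (fun χ x _ hχ => ?_) (by rw [zero_lie]; exact zero_mem _)
      (fun a b h1 h2 => by rw [add_lie]; exact add_mem h1 h2) (LieSubmodule.mem_top x)
    obtain ⟨z, hz, p, hp, rfl⟩ := Submodule.mem_sup.1 hm
    rw [lie_add]
    refine add_mem ?_ ?_
    · by_cases h0 : χ = 0
      · subst h0
        rw [hz.2 x (hc0 hχ)]
        exact zero_mem _
      · rw [← lie_skew]
        exact neg_mem (Submodule.mem_sup_right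
          (hP h0 _ ((rootSpace c χ).lie_mem (x := ⟨z, hz.1⟩) hχ)))
    · refine Submodule.iSup_induction _ (motive := fun p => ⁅x, p⁆ ∈ Zc ⊔ P) hp
        ?_ (by rw [lie_zero]; exact zero_mem _)
        (fun a b h1 h2 => by rw [lie_add]; exact add_mem h1 h2)
      rintro ⟨ψ, hψ⟩ u hu
      have h1 : ⁅x, u⁆ ∈ rootSpace c (χ + ψ) := lie_mem_genWeightSpace_of_mem_genWeightSpace hχ hu
      by_cases h0 : χ + ψ = 0
      · rw [h0] at h1
        by_cases hχ0 : χ = 0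
        · simp [hχ0, hψ] at h0
        · refine Submodule.mem_sup_left ⟨hc0 h1, fun y hy => ?_⟩
          have h2 := hroot hχ0 x hχ ⟨y, hy⟩
          have h3 := hroot hψ u hu ⟨y, hy⟩
          simp only at h2 h3
          rw [leibniz_lie, h2, h3, smul_lie, lie_smul, ← add_smul, ← Pi.add_apply, h0]
          simp
      · exact Submodule.mem_sup_right (hP h0 _ h1)
  let Q : LieIdeal K r := { Zc ⊔ P with lie_mem := fun {x m} hm => hlie x m hm }
  have hQmem : ∀ x, x ∈ Q ↔ x ∈ Zc ⊔ P := fun _ => Iff.rfl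
  have hZQ : ∀ x ∈ center K r, x ∈ Q := fun x hx =>
    Submodule.mem_sup_left ⟨hc0 (by
      rw [mem_genWeightSpace]
      exact fun y => ⟨1, by simpa using mem_center_iff.1 hx (y : r)⟩), fun y _ =>
        mem_center_iff.1 hx y⟩
  have hRQ : radical K r ≤ Q := by
    intro x hx
    refine LieIdeal.rootSpace_induction c (radical K r) (p := fun x => x ∈ Q)
      (fun χ x hx hχ => ?_) (zero_mem _) (fun a b h1 h2 => add_mem h1 h2) hx
    by_cases h0 : χ = 0
    · subst h0
      exact hZQ x (mem_center_of_mem_radical_of_mem_cartan c hred hx (hc0 hχ))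
    · exact Submodule.mem_sup_right (hP h0 x hχ)
  have hcQ : ∀ x : r, ∃ y ∈ c, x - y ∈ Q := by
    intro x
    refine LieIdeal.rootSpace_induction c (⊤ : LieIdeal K r) (p := fun x => ∃ y ∈ c, x - y ∈ Q)
      (fun χ x _ hχ => ?_) ⟨0, c.zero_mem, by simp⟩ ?_ (LieSubmodule.mem_top x)
    · by_cases h0 : χ = 0
      · subst h0
        exact ⟨x, hc0 hχ, by simp⟩
      · exact ⟨0, c.zero_mem, by
          rw [sub_zero, hQmem]
          exact Submodule.mem_sup_right (hP h0 x hχ)⟩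
    · rintro a b ⟨y, hy, h1⟩ ⟨y', hy', h2⟩
      refine ⟨y + y', c.add_mem hy hy', ?_⟩
      rw [add_sub_add_comm]
      exact add_mem h1 h2
  have hDQ : derivedSeries K r 1 ≤ Q := by
    rw [derivedSeries_def, derivedSeriesOfIdeal_succ, derivedSeriesOfIdeal_zero,
      LieSubmodule.lie_le_iff]
    intro x _ m _
    obtain ⟨y, hy, hxy⟩ := hcQ x
    obtain ⟨y', hy', hmy⟩ := hcQ m
    have : ⁅x, m⁆ = ⁅x - y, m⁆ + ⁅y, m - y'⁆ + ⁅y, y'⁆ := by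
      rw [sub_lie, lie_sub]
      abel
    rw [this]
    exact add_mem (add_mem (lie_mem_left K r Q _ _ hxy) (Q.lie_mem hmy)) (hZQ _ (hcc y hy y' hy'))
  have hQtop : ∀ x, x ∈ Q := by
    intro x
    have h1 := LieIdeal.derivedSeries_map_eq (R := K) 1 hf
    rw [derivedSeries_one_eq_top_of_isKilling (s := r ⧸ radical K r)] at h1
    have h2 : f x ∈ (derivedSeries K r 1).map f := by rw [h1]; exact LieSubmodule.mem_top _
    obtain ⟨d, hd⟩ := LieIdeal.mem_map_of_surjective hf h2
    have h3 : x - d ∈ radical K r := by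
      rw [← LieIdeal.quotientHom_eq_zero_iff, map_sub, sub_eq_zero]
      exact hd.symm
    have := add_mem (hRQ h3) (hDQ d.2)
    rwa [sub_add_cancel] at this
  obtain ⟨z, hz, p, hp, hzp⟩ := Submodule.mem_sup.1 ((hQmem y).1 (hQtop y))
  have hp0 : p = 0 := by
    have hpc : p ∈ rootSpace c (0 : c → K) :=
      hc0' (by rw [← add_sub_cancel_left z p, hzp]; exact c.sub_mem hy hz.1)
    have hind := (LieSubmodule.iSupIndep_toSubmodule.2
      (iSupIndep_genWeightSpace K c r)) (0 : c → K)
    have hPle : P ≤ ⨆ (χ : c → K) (_ : χ ≠ 0), (rootSpace c χ).toSubmodule :=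
      iSup_le fun χ => le_iSup₂_of_le χ.1 χ.2 le_rfl
    simpa using hind.le_bot ⟨hpc, hPle hp⟩
  rw [hp0, add_zero] at hzp
  rw [← hzp]
  exact hz.2 x hx

/-- Cartan subalgebras of a reductive Lie algebra act diagonalizably. -/
theorem lie_eq_smul_of_mem_rootSpace_cartan {χ : c → K} {u : r}
    (hu : u ∈ rootSpace c χ) (y : c) : ⁅(y : r), u⁆ = χ y • u := by
  by_cases h0 : χ = 0
  · subst h0
    rw [rootSpace_zero_eq] at hu
    rw [lie_eq_zero_of_mem_cartan c hred y.2 hu]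
    simp
  · exact lie_eq_smul_of_mem_rootSpace_of_ne_zero c hred h0 hu y

end Reductive

section Centralizer

open LieAlgebra LieModule

variable {K r : Type*} [Field K] [LieRing r] [LieAlgebra K r]

/-- The centralizer of a subalgebra. -/
def LieSubalgebra.centralizer (t : LieSubalgebra K r) : LieSubalgebra K r where
  carrier := {x | ∀ y ∈ t, ⁅y, x⁆ = 0}
  zero_mem' := fun _ _ => lie_zero _
  add_mem' := fun {a b} ha hb y hy => by rw [lie_add, ha y hy, hb y hy, add_zero]
  smul_mem' := fun c a ha y hy => by rw [lie_smul, ha y hy, smul_zero]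
  lie_mem' := fun {a b} ha hb y hy => by
    rw [leibniz_lie, ha y hy, hb y hy, zero_lie, lie_zero, add_zero]

variable [FiniteDimensional K r] [IsAlgClosed K] [CharZero K]
  (t : LieSubalgebra K r)
  (htc : ∀ y ∈ t, ∀ y' ∈ t, ⁅y, y'⁆ = 0)
  (hdiag : ∀ y ∈ t, ⨆ μ : K, (ad K r y).eigenspace μ = ⊤)

include htc hdiag

theorem exists_isCartanSubalgebra_ge_le_centralizer :
    ∃ c : LieSubalgebra K r, c.IsCartanSubalgebra ∧ t ≤ c ∧
      ((∀ x ∈ c, ∀ y ∈ t.centralizer, ⁅x, y⁆ = 0) → t.centralizer ≤ c) := by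
  let z := t.centralizer
  obtain ⟨x₀, hx₀⟩ := exists_isCartanSubalgebra_engel K z
  let c' := LieSubalgebra.engel K x₀
  have hn : ∀ x : z, (∀ y ∈ c', ⁅x, y⁆ ∈ c') → x ∈ c' := by
    intro x hx
    have := (LieSubalgebra.mem_normalizer_iff c' x).2 hx
    rwa [hx₀.self_normalizing] at this
  have htz : t ≤ z := fun y hy y' hy' => htc y' hy' y hy
  have hz : ∀ x ∈ z, ∀ y ∈ t, ⁅y, x⁆ = 0 := fun x hx => hx
  have htc' : ∀ y (hy : y ∈ t), (⟨y, htz hy⟩ : z) ∈ c' := by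
    intro y hy
    refine hn _ fun x _ => ?_
    have : ⁅(⟨y, htz hy⟩ : z), x⁆ = 0 := Subtype.ext (hz x x.2 y hy)
    rw [this]
    exact c'.zero_mem
  refine ⟨c'.map z.incl, ⟨?_, ?_⟩, fun y hy => ⟨⟨y, htz hy⟩, htc' y hy, rfl⟩, ?_⟩
  · let f : c' →ₗ⁅K⁆ c'.map z.incl :=
      { toFun := fun y => ⟨(y : z), ⟨y, y.2, rfl⟩⟩
        map_add' := fun _ _ => rfl
        map_smul' := fun _ _ => rfl
        map_lie' := rfl }
    have hf : Function.Surjective f := by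
      rintro ⟨_, y, hy, rfl⟩
      exact ⟨⟨y, hy⟩, rfl⟩
    exact hf.lieAlgebra_isNilpotent
  · refine le_antisymm (fun x hx => ?_) (LieSubalgebra.le_normalizer _)
    rw [LieSubalgebra.mem_normalizer_iff] at hx
    have hxz : x ∈ z := by
      intro y hy
      have h1 := hx y ⟨⟨y, htz hy⟩, htc' y hy, rfl⟩
      obtain ⟨w, -, hw⟩ := h1
      have hw' : (w : r) = ⁅x, y⁆ := hw
      have h2 : ⁅y, ⁅y, x⁆⁆ = 0 := by
        rw [← lie_skew y x, ← hw', lie_neg, hz w w.2 y hy, neg_zero]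
      have := apply_eq_smul_of_pow_apply_eq_zero (ad K r y) (hdiag y hy) 0 2 x
        (by simpa [pow_two] using h2)
      simpa using this
    refine ⟨⟨x, hxz⟩, hn _ fun y hy => ?_, rfl⟩
    obtain ⟨w, hw, hw'⟩ := hx y ⟨y, hy, rfl⟩
    have : w = ⁅(⟨x, hxz⟩ : z), y⁆ := Subtype.ext hw'
    exact this ▸ hw
  · intro h x hx
    refine ⟨⟨x, hx⟩, hn _ fun y hy => ?_, rfl⟩
    have : ⁅(⟨x, hx⟩ : z), y⁆ = 0 := by
      refine Subtype.ext ?_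
      change ⁅x, (y : r)⁆ = 0
      rw [← lie_skew, h y ⟨y, hy, rfl⟩ x hx, neg_zero]
    rw [this]
    exact c'.zero_mem

theorem mem_of_forall_lie_eq_zero
    (hmax : ∀ c : LieSubalgebra K r, c.IsCartanSubalgebra → t ≤ c → c ≤ t)
    {x : r} (hx : ∀ y ∈ t, ⁅y, x⁆ = 0) : x ∈ t := by
  obtain ⟨c, hc, htc, h⟩ := exists_isCartanSubalgebra_ge_le_centralizer t htc hdiag
  have hct := hmax c hc htc
  exact hct (h (fun x hx y hy => hy x (hct hx)) hx)

end Centralizer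

section Induction

open UniversalEnvelopingAlgebra

attribute [local instance] LieRing.ofAssociativeRing

theorem UniversalEnvelopingAlgebra.induction_of_lie {K L : Type*} [CommRing K] [LieRing L]
    [LieAlgebra K L] {p : UniversalEnvelopingAlgebra K L → Prop} (h1 : p 1) (h0 : p 0)
    (hadd : ∀ u v, p u → p v → p (u + v)) (hsmul : ∀ (c : K) u, p u → p (c • u))
    (hlie : ∀ (y : L) u, p u → p (ι K y * u)) (u : UniversalEnvelopingAlgebra K L) : p u := by
  let N : Submodule K (UniversalEnvelopingAlgebra K L) :=
    { carrier := {u | p u}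
      zero_mem' := h0
      add_mem' := fun {a b} ha hb => hadd a b ha hb
      smul_mem' := hsmul }
  let B : Subalgebra K (UniversalEnvelopingAlgebra K L) :=
    { carrier := {x | ∀ u ∈ N, x * u ∈ N}
      mul_mem' := fun {a b} ha hb u hu => by rw [mul_assoc]; exact ha _ (hb u hu)
      add_mem' := fun {a b} ha hb u hu => by rw [add_mul]; exact N.add_mem (ha u hu) (hb u hu)
      algebraMap_mem' := fun c u hu => by
        rw [← Algebra.smul_def]; exact N.smul_mem c hu }
  let f : L →ₗ⁅K⁆ B :=
    { toFun := fun y => ⟨ι K y, hlie y⟩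
      map_add' := fun a b => Subtype.ext (map_add (ι K) a b)
      map_smul' := fun c a => Subtype.ext (map_smul (ι K) c a)
      map_lie' := fun {a b} => Subtype.ext (LieHom.map_lie (ι K) a b) }
  let F : UniversalEnvelopingAlgebra K L →ₐ[K] B := lift K f
  have hf : B.val.comp F = AlgHom.id K (UniversalEnvelopingAlgebra K L) := by
    refine UniversalEnvelopingAlgebra.hom_ext (R := K) (LieHom.ext fun y => ?_)
    change ((lift K f (ι K y) : B) : UniversalEnvelopingAlgebra K L) = ι K y
    rw [lift_ι_apply]
    rfl
  have h2 : u ∈ B := by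
    have h := DFunLike.congr_fun hf u
    change ((F u : B) : UniversalEnvelopingAlgebra K L) = u at h
    rw [← h]
    exact (F u).2
  have := h2 1 h1
  rwa [mul_one] at this

instance UniversalEnvelopingAlgebra.instNontrivial {K L : Type*} [CommRing K] [Nontrivial K]
    [LieRing L] [LieAlgebra K L] : Nontrivial (UniversalEnvelopingAlgebra K L) :=
  (lift K (0 : L →ₗ⁅K⁆ K)).toRingHom.domain_nontrivial

end Induction

section Prolong

variable {K g U : Type*} [CommRing K] [LieRing g] [LieAlgebra K g] [Ring U] [Algebra K U]
  {n b : LieSubalgebra K g} (p : g →ₗ[K] n) (q : g →ₗ[K] b) (j : n →ₗ[K] U)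

/-- The operator by which `y ∈ n` prolongs an element `w` of a representation `U` of `n`,
together with prescribed values `a X = X • w` for `X ∈ b`, to `y • w`. -/
def prolong (y : n) : Module.End K (U × (b →ₗ[K] U)) where
  toFun v := (j y * v.1,
    { toFun := fun X => j y * v.2 X + j (p ⁅(X : g), (y : g)⁆) * v.1 + v.2 (q ⁅(X : g), (y : g)⁆)
      map_add' := fun X X' => by
        have h : ((X + X' : b) : g) = X + X' := rfl
        rw [h, add_lie, map_add, map_add, map_add, map_add, map_add, mul_add,
          add_mul]
        abel
      map_smul' := fun c X => by
        have h : ((c • X : b) : g) = c • (X : g) := rfl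
        rw [h, smul_lie, map_smul, map_smul, map_smul, map_smul, map_smul,
          RingHom.id_apply, smul_add, smul_add, mul_smul_comm, smul_mul_assoc] })
  map_add' v w := by
    refine Prod.ext (mul_add _ _ _) (LinearMap.ext fun X => ?_)
    change j y * (v.2 X + w.2 X) + j (p ⁅(X : g), (y : g)⁆) * (v.1 + w.1) +
      (v.2 (q ⁅(X : g), (y : g)⁆) + w.2 (q ⁅(X : g), (y : g)⁆)) =
      (j y * v.2 X + j (p ⁅(X : g), (y : g)⁆) * v.1 + v.2 (q ⁅(X : g), (y : g)⁆)) +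
      (j y * w.2 X + j (p ⁅(X : g), (y : g)⁆) * w.1 + w.2 (q ⁅(X : g), (y : g)⁆))
    rw [mul_add, mul_add]
    abel
  map_smul' c v := by
    refine Prod.ext (mul_smul_comm _ _ _) (LinearMap.ext fun X => ?_)
    change j y * (c • v.2 X) + j (p ⁅(X : g), (y : g)⁆) * (c • v.1) +
      c • v.2 (q ⁅(X : g), (y : g)⁆) =
      c • (j y * v.2 X + j (p ⁅(X : g), (y : g)⁆) * v.1 + v.2 (q ⁅(X : g), (y : g)⁆))
    rw [mul_smul_comm, mul_smul_comm, smul_add, smul_add]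

theorem prolong_fst (y : n) (v : U × (b →ₗ[K] U)) : (prolong p q j y v).1 = j y * v.1 := rfl

theorem prolong_snd (y : n) (v : U × (b →ₗ[K] U)) (X : b) : (prolong p q j y v).2 X =
    j y * v.2 X + j (p ⁅(X : g), (y : g)⁆) * v.1 + v.2 (q ⁅(X : g), (y : g)⁆) := rfl

theorem prolong_lie (hpq : ∀ z, (p z : g) + q z = z) (hp : ∀ y : n, p y = y)
    (hq : ∀ y : n, q y = 0)
    (hj : ∀ y y', j ⁅y, y'⁆ = j y * j y' - j y' * j y) (y y' : n) :
    prolong p q j ⁅y, y'⁆ =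
      prolong p q j y * prolong p q j y' - prolong p q j y' * prolong p q j y := by
  refine LinearMap.ext fun v => ?_
  rw [LinearMap.sub_apply, Module.End.mul_apply, Module.End.mul_apply]
  refine Prod.ext ?_ (LinearMap.ext fun X => ?_)
  · rw [Prod.fst_sub]
    simp only [prolong_fst]
    rw [hj, sub_mul, mul_assoc, mul_assoc]
  · rw [Prod.snd_sub, LinearMap.sub_apply]
    simp only [prolong_snd, prolong_fst]
    have hX : ⁅(X : g), ((⁅y, y'⁆ : n) : g)⁆ =
        (⁅p ⁅(X : g), (y : g)⁆, y'⁆ : n) + ⁅(q ⁅(X : g), (y : g)⁆ : g), (y' : g)⁆ -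
        ((⁅p ⁅(X : g), (y' : g)⁆, y⁆ : n) + ⁅(q ⁅(X : g), (y' : g)⁆ : g), (y : g)⁆) := by
      rw [LieSubalgebra.coe_bracket, LieSubalgebra.coe_bracket, LieSubalgebra.coe_bracket,
        ← add_lie, ← add_lie, hpq, hpq, leibniz_lie, ← lie_skew ⁅(X : g), (y' : g)⁆ (y : g)]
      abel
    rw [hX]
    simp only [map_sub, map_add, hp, hq, hj, zero_add]
    noncomm_ring

open UniversalEnvelopingAlgebra in
/-- The module induced from the character `lam` of `b`, realised on `U(n)` when
`g = n ⊕ b`. -/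
theorem exists_induced_representation (hpq : ∀ z, (p z : g) + q z = z) (hp : ∀ y : n, p y = y)
    (hq : ∀ y : n, q y = 0) (hp' : ∀ X : b, p X = 0) (hq' : ∀ X : b, q X = X)
    (lam : b →ₗ[K] K) (hlam : ∀ X X' : b, lam ⁅X, X'⁆ = 0) :
    ∃ f : g →ₗ[K] Module.End K (UniversalEnvelopingAlgebra K n),
      (∀ x y m, f ⁅x, y⁆ m = f x (f y m) - f y (f x m)) ∧ ∀ X : b, f X 1 = lam X • 1 := by
  let _ : LieRing (Module.End K (UniversalEnvelopingAlgebra K n ×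
    (b →ₗ[K] UniversalEnvelopingAlgebra K n))) := LieRing.ofAssociativeRing
  let _ : LieRing (UniversalEnvelopingAlgebra K n) := LieRing.ofAssociativeRing
  let j : n →ₗ[K] UniversalEnvelopingAlgebra K n := (ι K : n →ₗ⁅K⁆ UniversalEnvelopingAlgebra K n)
  have hj : ∀ y y', j ⁅y, y'⁆ = j y * j y' - j y' * j y := fun y y' => LieHom.map_lie (ι K) y y'
  let r : n →ₗ⁅K⁆ Module.End K (UniversalEnvelopingAlgebra K n ×
      (b →ₗ[K] UniversalEnvelopingAlgebra K n)) :=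
    { toFun := prolong p q j
      map_add' := fun y y' => by
        refine LinearMap.ext fun v => Prod.ext ?_ (LinearMap.ext fun X => ?_)
        · rw [LinearMap.add_apply, Prod.fst_add]
          simp only [prolong_fst, map_add, add_mul]
        · have h : ((y + y' : n) : g) = y + y' := rfl
          rw [LinearMap.add_apply, Prod.snd_add, LinearMap.add_apply]
          simp only [prolong_snd, h, lie_add, map_add, add_mul]
          abel
      map_smul' := fun c y => by
        refine LinearMap.ext fun v => Prod.ext ?_ (LinearMap.ext fun X => ?_)
        · simp only [RingHom.id_apply, LinearMap.smul_apply, Prod.smul_fst, prolong_fst, map_smul,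
            smul_mul_assoc]
        · have h : ((c • y : n) : g) = c • (y : g) := rfl
          simp only [RingHom.id_apply, LinearMap.smul_apply, Prod.smul_snd, prolong_snd, h, lie_smul,
            map_smul, smul_mul_assoc, smul_add]
      map_lie' := fun {y y'} => prolong_lie p q j hpq hp hq hj y y' }
  let R := lift K r
  let v₀ : UniversalEnvelopingAlgebra K n × (b →ₗ[K] UniversalEnvelopingAlgebra K n) :=
    (1, lam.smulRight 1)
  have hR : ∀ y u, R (ι K y * u) v₀ = prolong p q j y (R u v₀) := by
    intro y u
    rw [map_mul, lift_ι_apply]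
    rfl
  have hR1 : ∀ u, (R u v₀).1 = u := by
    refine induction_of_lie ?_ ?_ ?_ ?_ ?_
    · rw [map_one]
      rfl
    · rw [map_zero]
      rfl
    · intro u v hu hv
      rw [map_add, LinearMap.add_apply, Prod.fst_add, hu, hv]
    · intro c u hu
      rw [map_smul, LinearMap.smul_apply, Prod.smul_fst, hu]
    · intro y u hu
      rw [hR, prolong_fst, hu]
      rfl
  let f : g →ₗ[K] Module.End K (UniversalEnvelopingAlgebra K n) :=
    LinearMap.mk₂ K (fun z u => j (p z) * u + (R u v₀).2 (q z))
      (fun z z' u => by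
        rw [map_add, map_add, map_add, map_add, add_mul]
        abel)
      (fun c z u => by
        rw [map_smul, map_smul, map_smul, map_smul, smul_add, smul_mul_assoc])
      (fun z u u' => by
        rw [map_add, LinearMap.add_apply, Prod.snd_add, LinearMap.add_apply, mul_add]
        abel)
      (fun c z u => by
        rw [map_smul, LinearMap.smul_apply, Prod.smul_snd, LinearMap.smul_apply, smul_add,
          mul_smul_comm])
  have hf : ∀ z u, f z u = j (p z) * u + (R u v₀).2 (q z) := fun _ _ => rfl
  have hfn : ∀ (y : n) u, f y u = j y * u := fun y u => by rw [hf, hp, hq, map_zero, add_zero]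
  have hfb : ∀ (X : b) u, f X u = (R u v₀).2 X := fun X u => by
    rw [hf, hp', hq', map_zero, zero_mul, zero_add]
  have hsplit : ∀ z u, f z u = f (p z) u + f (q z) u := fun z u => by
    rw [← LinearMap.add_apply, ← map_add, hpq]
  have hmix : ∀ z (y : n) u, f z (f y u) = f y (f z u) + f ⁅z, (y : g)⁆ u := by
    intro z y u
    have h1 : ∀ X : b, f X (f y u) = f y (f X u) + f ⁅(X : g), (y : g)⁆ u := by
      intro X
      rw [hf ⁅_, _⁆, hfb, hfn, hfn, hfb]
      change (R (ι K y * u) v₀).2 X = _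
      rw [hR, prolong_snd, hR1, add_assoc]
    have h2 : ∀ y' : n, f y' (f y u) = f y (f y' u) + f ⁅(y' : g), (y : g)⁆ u := by
      intro y'
      have h3 : f ⁅(y' : g), (y : g)⁆ u = j ⁅y', y⁆ * u := hfn ⁅y', y⁆ u
      rw [h3, hfn, hfn, hfn, hfn, hj, sub_mul, mul_assoc, mul_assoc]
      abel
    have h3 : ⁅z, (y : g)⁆ = ⁅(p z : g), (y : g)⁆ + ⁅(q z : g), (y : g)⁆ := by
      rw [← add_lie, hpq]
    rw [hsplit z (f y u), h1, h2, h3, map_add, LinearMap.add_apply, hsplit z u, map_add]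
    abel
  have hf1 : ∀ X : b, f X 1 = lam X • 1 := fun X => by
    rw [hfb, map_one]
    rfl
  refine ⟨f, fun x x' m => ?_, hf1⟩
  rw [eq_sub_iff_add_eq]
  revert x x'
  refine induction_of_lie (p := fun m => ∀ x x', f ⁅x, x'⁆ m + f x' (f x m) = f x (f x' m))
    ?_ ?_ ?_ ?_ ?_ m
  · have h1 : ∀ (z : g) (y : n), f ⁅z, (y : g)⁆ 1 + f y (f z 1) = f z (f y 1) := fun z y => by
      rw [hmix z y, add_comm]
    intro x x'
    have h2 : ∀ (X X' : b), f ⁅(X : g), (X' : g)⁆ 1 + f X' (f X 1) = f X (f X' 1) := by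
      intro X X'
      have h3 : f ⁅(X : g), (X' : g)⁆ 1 = lam ⁅X, X'⁆ • 1 := hf1 ⁅X, X'⁆
      rw [h3, hlam, zero_smul, zero_add, hf1, hf1, map_smul, map_smul, hf1, hf1, smul_comm]
    have h3 : ∀ (y : n) (z : g), f ⁅(y : g), z⁆ 1 + f z (f y 1) = f y (f z 1) := fun y z => by
      rw [hmix z y, ← lie_skew, map_neg, LinearMap.neg_apply]
      abel
    have h4 : ∀ (X : b) z, f ⁅(X : g), z⁆ 1 + f z (f X 1) = f X (f z 1) := fun X z => by
      have h5 : ⁅(X : g), z⁆ = ⁅(X : g), (p z : g)⁆ + ⁅(X : g), (q z : g)⁆ := by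
        rw [← lie_add, hpq]
      rw [h5, hsplit z 1, map_add, map_add, LinearMap.add_apply, ← h1, ← h2, hsplit z]
      abel
    have h5 : ⁅x, x'⁆ = ⁅(p x : g), x'⁆ + ⁅(q x : g), x'⁆ := by
      rw [← add_lie, hpq]
    rw [h5, hsplit x (f x' 1), hsplit x 1, map_add, map_add, LinearMap.add_apply, ← h3, ← h4]
    abel
  · intro x x'
    simp only [map_zero, add_zero]
  · intro u v hu hv x x'
    rw [map_add, map_add, map_add, map_add, map_add, ← hu x x', ← hv x x']
    abel
  · intro c u hu x x'
    rw [map_smul, map_smul, map_smul, map_smul, map_smul, ← hu x x', smul_add]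
  · intro y u hu x x'
    change f ⁅x, x'⁆ (j y * u) + f x' (f x (j y * u)) = f x (f x' (j y * u))
    rw [← hfn, hmix, hmix x, hmix x', map_add, map_add, hmix, hmix, ← hu x x', ← hu ⁅x, (y : g)⁆ x',
      ← hu x ⁅x', (y : g)⁆, map_add]
    have h : ⁅⁅x, x'⁆, (y : g)⁆ = ⁅x, ⁅x', (y : g)⁆⁆ + ⁅⁅x, (y : g)⁆, x'⁆ := by
      rw [lie_lie, ← lie_skew x' ⁅x, (y : g)⁆, sub_neg_eq_add]
    rw [h, map_add, LinearMap.add_apply]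
    abel

end Prolong

namespace Paper

section MaximalToral

open LieAlgebra LieModule

variable {K : Type} [Field K] [IsAlgClosed K] [CharZero K]
variable {g : Type} [LieRing g] [LieAlgebra K g]

theorem isToralIn_map_incl (s : LieSubalgebra K g) [FiniteDimensional K s]
    (hred : ∀ I : LieIdeal K s, IsLieAbelian I → I ≤ center K s)
    (c : LieSubalgebra K s) [c.IsCartanSubalgebra] : IsToralIn K g s (c.map s.incl) := by
  have hmem : ∀ y : c.map s.incl, ∃ hy : (y : g) ∈ s, (⟨y, hy⟩ : s) ∈ c := by
    rintro ⟨_, y, hy, rfl⟩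
    exact ⟨y.2, hy⟩
  let e : c.map s.incl →ₗ[K] c :=
    { toFun := fun y => ⟨⟨y, (hmem y).1⟩, (hmem y).2⟩
      map_add' := fun _ _ => rfl
      map_smul' := fun _ _ => rfl }
  refine ⟨?_, ⟨?_⟩, ?_⟩
  · rintro _ ⟨y, -, rfl⟩
    exact y.2
  · rintro ⟨_, y, hy, rfl⟩ ⟨_, y', hy', rfl⟩
    have h := congrArg Subtype.val (lie_eq_zero_of_mem_cartan c hred hy hy')
    exact Subtype.ext h
  · intro x hx
    refine LieIdeal.rootSpace_induction c (⊤ : LieIdeal K s)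
      (p := fun x => (x : g) ∈ ⨆ α : Module.Dual K (c.map s.incl),
        s.toSubmodule ⊓ adWeightSpace K g (c.map s.incl) α)
      (fun χ a _ hχ => ?_) (zero_mem _) (fun a b h1 h2 => add_mem h1 h2)
      (LieSubmodule.mem_top (⟨x, hx⟩ : s))
    by_cases h0 : rootSpace c χ = ⊥
    · rw [h0, LieSubmodule.mem_bot] at hχ
      rw [hχ]
      exact zero_mem _
    · let w : Weight K c s := ⟨χ, h0⟩
      refine Submodule.mem_iSup_of_mem ((Weight.toLinear K c s w).comp e) ⟨a.2, fun H => ?_⟩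
      exact congrArg Subtype.val (lie_eq_smul_of_mem_rootSpace_cartan c hred hχ (e H))

theorem IsMaxToralIn.mem_of_forall_lie_eq_zero {s t : LieSubalgebra K g}
    (ht : IsMaxToralIn K g s t) [FiniteDimensional K s]
    (hred : ∀ I : LieIdeal K s, IsLieAbelian I → I ≤ center K s)
    {x : g} (hxs : x ∈ s) (hx : ∀ y ∈ t, ⁅y, x⁆ = 0) : x ∈ t := by
  obtain ⟨⟨hts, hab, hspan⟩, hmax⟩ := ht
  let T : LieSubalgebra K s := t.comap s.incl
  have hT : ∀ y : s, y ∈ T ↔ (y : g) ∈ t := fun _ => Iff.rfl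
  suffices h : (⟨x, hxs⟩ : s) ∈ T from h
  refine _root_.mem_of_forall_lie_eq_zero T ?_ ?_ ?_ ?_
  · intro y hy y' hy'
    have h := congrArg Subtype.val (hab.trivial ⟨(y : g), hy⟩ ⟨(y' : g), hy'⟩)
    exact Subtype.ext h
  · intro y hy
    rw [eq_top_iff]
    rintro ⟨v, hv⟩ -
    let N : Submodule K g := (⨆ μ : K, (ad K s y).eigenspace μ).map s.toSubmodule.subtype
    have hN : v ∈ N := by
      refine (hspan.trans (iSup_le fun α w hw => ?_)) hv
      refine ⟨⟨w, hw.1⟩, Submodule.mem_iSup_of_mem (α ⟨y, hy⟩)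
        (Module.End.mem_eigenspace_iff.2 (Subtype.ext ?_)), rfl⟩
      exact hw.2 ⟨y, hy⟩
    obtain ⟨v', hv', h⟩ := hN
    have : v' = ⟨v, hv⟩ := Subtype.ext h
    exact this ▸ hv'
  · intro c hc hTc y hy
    have h1 := hmax _ (isToralIn_map_incl s hred c) fun y hy => ⟨⟨y, hts hy⟩, hTc hy, rfl⟩
    rw [hT, ← h1]
    exact ⟨y, hy, rfl⟩
  · intro y hy
    exact Subtype.ext (hx y hy)

namespace Setup

variable (S : Setup K g)

theorem h_lie_eq_zero {x y : g} (hx : x ∈ S.h) (hy : y ∈ S.h) : ⁅x, y⁆ = 0 := by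
  obtain ⟨n, hn⟩ := S.F_exhaust x
  obtain ⟨m, hm⟩ := S.F_exhaust y
  have hx' : x ∈ S.h ⊓ S.F (max n m) := ⟨hx, S.F_mono (le_max_left n m) hn⟩
  have hy' : y ∈ S.h ⊓ S.F (max n m) := ⟨hy, S.F_mono (le_max_right n m) hm⟩
  exact congrArg Subtype.val ((S.h_maxToral (max n m)).1.2.1.trivial ⟨x, hx'⟩ ⟨y, hy'⟩)

theorem adWeightSpace_zero : adWeightSpace K g S.h 0 = S.h.toSubmodule := by
  refine le_antisymm (fun x hx => ?_) (fun x hx H => ?_)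
  · obtain ⟨n, hn⟩ := S.F_exhaust x
    have := S.F_findim n
    refine ((S.h_maxToral n).mem_of_forall_lie_eq_zero (S.F_reductive n) hn fun y hy => ?_).1
    have := hx ⟨y, hy.1⟩
    simpa using this
  · rw [S.h_lie_eq_zero H.2 hx, LinearMap.zero_apply, zero_smul]

end Setup

end MaximalToral

namespace Setup

section Triangular

variable {K : Type} [Field K] [IsAlgClosed K] [CharZero K]
variable {g : Type} [LieRing g] [LieAlgebra K g] (S : Setup K g)

/-- The sum of the weight spaces of `g` with weight in `s`. -/
def adSum (s : Set (Module.Dual K S.h)) : Submodule K g := ⨆ α ∈ s, adWeightSpace K g S.h α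

/-- The negative roots. -/
def negRoots : Set (Module.Dual K S.h) := {α | IsRootOf K g S.h α ∧ α ∉ S.pos}

variable {S}

theorem adWeightSpace_le_adSum {s : Set (Module.Dual K S.h)} {α : Module.Dual K S.h}
    (hα : α ∈ s) : adWeightSpace K g S.h α ≤ S.adSum s :=
  le_iSup₂_of_le α hα le_rfl

theorem lie_mem_adWeightSpace {α β : Module.Dual K S.h} {x y : g}
    (hx : x ∈ adWeightSpace K g S.h α) (hy : y ∈ adWeightSpace K g S.h β) :
    ⁅x, y⁆ ∈ adWeightSpace K g S.h (α + β) := fun H => by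
  rw [leibniz_lie, hx H, hy H, smul_lie, lie_smul, LinearMap.add_apply, add_smul]

theorem adSum_induction {s : Set (Module.Dual K S.h)} {p : g → Prop}
    (h : ∀ α ∈ s, ∀ x ∈ adWeightSpace K g S.h α, p x) (h0 : p 0)
    (hadd : ∀ x y, p x → p y → p (x + y)) {x : g} (hx : x ∈ S.adSum s) : p x := by
  refine Submodule.iSup_induction _ (motive := p) hx (fun α x hx => ?_) h0 hadd
  exact Submodule.iSup_induction _ (motive := p) hx (fun hα x hx => h α hα x hx) h0 hadd

theorem lie_mem_adSum {s t u : Set (Module.Dual K S.h)}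
    (h : ∀ α ∈ s, ∀ β ∈ t, ∀ x ∈ adWeightSpace K g S.h α, ∀ y ∈ adWeightSpace K g S.h β,
      ⁅x, y⁆ ∈ S.adSum u) {x y : g} (hx : x ∈ S.adSum s) (hy : y ∈ S.adSum t) :
    ⁅x, y⁆ ∈ S.adSum u := by
  refine adSum_induction (p := fun x => ⁅x, y⁆ ∈ S.adSum u) (fun α hα x hx => ?_) ?_ ?_ hx
  · refine adSum_induction (p := fun y => ⁅x, y⁆ ∈ S.adSum u) (fun β hβ y hy => ?_) ?_ ?_ hy
    · exact h α hα β hβ x hx y hy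
    · rw [lie_zero]
      exact zero_mem _
    · intro a b ha hb
      rw [lie_add]
      exact add_mem ha hb
  · rw [zero_lie]
    exact zero_mem _
  · intro a b ha hb
    rw [add_lie]
    exact add_mem ha hb

theorem mem_adSum_of_isRootOf {α : Module.Dual K S.h} {s : Set (Module.Dual K S.h)} {x : g}
    (hx : x ∈ adWeightSpace K g S.h α) (hα : α ≠ 0) (h : IsRootOf K g S.h α → α ∈ s) :
    x ∈ S.adSum s := by
  by_cases h0 : x = 0
  · rw [h0]
    exact zero_mem _
  · exact adWeightSpace_le_adSum (h ⟨hα, fun h => h0 (by rwa [h, Submodule.mem_bot] at hx)⟩) hx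

theorem neg_mem_pos {α : Module.Dual K S.h} (hα : α ∈ S.negRoots) : -α ∈ S.pos := by
  have := hα.2
  rwa [S.pos_polar α hα.1, not_not] at this

theorem neg_notMem_pos {α : Module.Dual K S.h} (hα : α ∈ S.pos) : -α ∉ S.pos :=
  (S.pos_polar α (S.pos_root α hα)).1 hα

theorem zero_notMem_pos : (0 : Module.Dual K S.h) ∉ S.pos := fun h => (S.pos_root 0 h).1 rfl

theorem lie_mem_nplus {x y : g} (hx : x ∈ S.nplus) (hy : y ∈ S.nplus) : ⁅x, y⁆ ∈ S.nplus := by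
  refine lie_mem_adSum (s := S.pos) (t := S.pos) (u := S.pos) ?_ hx hy
  intro α hα β hβ x hx y hy
  refine mem_adSum_of_isRootOf (lie_mem_adWeightSpace hx hy) (fun h => ?_) (S.pos_add α hα β hβ)
  exact neg_notMem_pos hα (by rwa [neg_eq_of_add_eq_zero_right h])

theorem h_lie_mem_nplus {x y : g} (hx : x ∈ S.h) (hy : y ∈ S.nplus) : ⁅x, y⁆ ∈ S.nplus :=
  adSum_induction (s := S.pos) (p := fun y => ⁅x, y⁆ ∈ S.nplus)
    (fun α hα y hy => by
      have h := hy ⟨x, hx⟩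
      rw [h]
      exact Submodule.smul_mem _ _ (adWeightSpace_le_adSum hα hy))
    (by rw [lie_zero]; exact zero_mem _)
    (fun a b ha hb => by rw [lie_add]; exact add_mem ha hb) hy

theorem lie_mem_adSum_negRoots {x y : g} (hx : x ∈ S.adSum S.negRoots)
    (hy : y ∈ S.adSum S.negRoots) : ⁅x, y⁆ ∈ S.adSum S.negRoots := by
  refine lie_mem_adSum ?_ hx hy
  intro α hα β hβ x hx y hy
  refine mem_adSum_of_isRootOf (lie_mem_adWeightSpace hx hy) (fun h => ?_)
    fun h => ⟨h, S.neg_add α β hα.1 hβ.1 hα.2 hβ.2 h⟩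
  exact hβ.2 (by rw [← neg_eq_of_add_eq_zero_right h]; exact neg_mem_pos hα)

theorem lie_mem_nplus_of_mem_b {x y : g} (hx : x ∈ S.b) (hy : y ∈ S.b) : ⁅x, y⁆ ∈ S.nplus := by
  have hb : ∀ z ∈ S.b, ∃ a ∈ S.h, ∃ c ∈ S.nplus, a + c = z := fun z hz => by
    have hz' : z ∈ S.b.toSubmodule := hz
    rw [S.b_eq] at hz'
    exact Submodule.mem_sup.1 hz'
  obtain ⟨a, ha, c, hc, rfl⟩ := hb x hx
  obtain ⟨a', ha', c', hc', rfl⟩ := hb y hy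
  rw [add_lie, lie_add, lie_add, S.h_lie_eq_zero ha ha', zero_add]
  refine add_mem (h_lie_mem_nplus ha hc') (add_mem ?_ (lie_mem_nplus hc hc'))
  rw [← lie_skew]
  exact neg_mem (h_lie_mem_nplus ha' hc)

variable (S)

/-- The nilpotent subalgebra opposite to `n⁺`. -/
def nminus : LieSubalgebra K g where
  toSubmodule := S.adSum S.negRoots
  lie_mem' := lie_mem_adSum_negRoots

theorem disjoint_adSum {s t : Set (Module.Dual K S.h)} (h : Disjoint s t) :
    Disjoint (S.adSum s) (S.adSum t) :=
  S.h_indep.disjoint_biSup_biSup h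

theorem adSum_sup (s t : Set (Module.Dual K S.h)) :
    S.adSum s ⊔ S.adSum t = S.adSum (s ∪ t) := iSup_union.symm

theorem adSum_eq_top {s : Set (Module.Dual K S.h)}
    (h : ∀ α, α = 0 ∨ IsRootOf K g S.h α → α ∈ s) : S.adSum s = ⊤ := by
  rw [eq_top_iff, ← S.h_span, iSup_le_iff]
  intro α x hx
  by_cases h0 : α = 0
  · exact adWeightSpace_le_adSum (h α (.inl h0)) hx
  · exact mem_adSum_of_isRootOf hx h0 fun hα => h α (.inr hα)

theorem h_eq_adSum : S.h.toSubmodule = S.adSum {0} := by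
  rw [adSum, iSup_singleton, S.adWeightSpace_zero]

theorem b_eq_adSum : S.b.toSubmodule = S.adSum ({0} ∪ S.pos) := by
  rw [← adSum_sup, ← h_eq_adSum, S.b_eq, adSum]

theorem zero_notMem_negRoots : (0 : Module.Dual K S.h) ∉ S.negRoots := fun h => h.1.1 rfl

theorem isCompl_nminus_b : IsCompl S.nminus.toSubmodule S.b.toSubmodule := by
  rw [b_eq_adSum]
  change IsCompl (S.adSum S.negRoots) _
  refine ⟨S.disjoint_adSum ?_, ?_⟩
  · rw [Set.disjoint_union_right, Set.disjoint_singleton_right]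
    exact ⟨S.zero_notMem_negRoots, Set.disjoint_left.2 fun α hα h => hα.2 h⟩
  · rw [codisjoint_iff, adSum_sup]
    refine S.adSum_eq_top ?_
    rintro α (rfl | hα)
    · exact .inr (.inl rfl)
    · by_cases h : α ∈ S.pos
      · exact .inr (.inr h)
      · exact .inl ⟨hα, h⟩

theorem isCompl_h : IsCompl S.h.toSubmodule (S.adSum (S.pos ∪ S.negRoots)) := by
  rw [h_eq_adSum]
  refine ⟨S.disjoint_adSum ?_, ?_⟩
  · rw [Set.disjoint_singleton_left]
    rintro (h | h)
    · exact zero_notMem_pos h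
    · exact S.zero_notMem_negRoots h
  · rw [codisjoint_iff, adSum_sup]
    refine S.adSum_eq_top ?_
    rintro α (rfl | hα)
    · exact .inl rfl
    · by_cases h : α ∈ S.pos
      · exact .inr (.inl h)
      · exact .inr (.inr ⟨hα, h⟩)

/-- A functional on `h`, extended to `b` by zero on `n⁺`. -/
noncomputable def extendToB (lam : Module.Dual K S.h) : S.b →ₗ[K] K :=
  (lam.comp (Submodule.projectionOnto _ _ S.isCompl_h)).comp S.b.toSubmodule.subtype

variable {S}

theorem nplus_le_b : S.nplus ≤ S.b.toSubmodule := by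
  rw [S.b_eq]
  exact le_sup_right

theorem h_le_b : S.h.toSubmodule ≤ S.b.toSubmodule := by
  rw [S.b_eq]
  exact le_sup_left

theorem extendToB_nplus (lam : Module.Dual K S.h) {X : S.b} (hX : (X : g) ∈ S.nplus) :
    S.extendToB lam X = 0 := by
  have h : (X : g) ∈ S.adSum (S.pos ∪ S.negRoots) :=
    (le_sup_left.trans_eq (S.adSum_sup S.pos S.negRoots)) hX
  change lam (Submodule.projectionOnto _ _ S.isCompl_h (X : g)) = 0
  rw [(Submodule.projectionOnto_apply_eq_zero_iff S.isCompl_h).2 h, map_zero]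

theorem extendToB_h (lam : Module.Dual K S.h) (H : S.h) {X : S.b} (hX : (X : g) = H) :
    S.extendToB lam X = lam H := by
  change lam (Submodule.projectionOnto _ _ S.isCompl_h (X : g)) = lam H
  rw [hX]
  exact congrArg lam (Submodule.projectionOnto_apply_left S.isCompl_h H)

theorem one_notMem_vermaIdeal (lam : Module.Dual K S.h) : (1 : Env K g) ∉ S.vermaIdeal lam := by
  have hc := S.isCompl_nminus_b
  obtain ⟨f, hf, hf1⟩ := exists_induced_representation (n := S.nminus) (b := S.b)
    (Submodule.projectionOnto _ _ hc) (Submodule.projectionOnto _ _ hc.symm)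
    (fun z => Submodule.projection_add_projection_eq_self hc z)
    (fun y => Submodule.projectionOnto_apply_left hc y)
    (fun y => Submodule.projectionOnto_apply_right hc.symm y)
    (fun X => Submodule.projectionOnto_apply_right hc X)
    (fun X => Submodule.projectionOnto_apply_left hc.symm X)
    (S.extendToB lam) fun X X' => extendToB_nplus lam (lie_mem_nplus_of_mem_b X.2 X'.2)
  let _ : LieRing (Module.End K (UniversalEnvelopingAlgebra K S.nminus)) :=
    LieRing.ofAssociativeRing
  let r : g →ₗ⁅K⁆ Module.End K (UniversalEnvelopingAlgebra K S.nminus) :=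
    { f with map_lie' := fun {x y} => LinearMap.ext (hf x y) }
  let R : Env K g →ₐ[K] Module.End K (UniversalEnvelopingAlgebra K S.nminus) :=
    UniversalEnvelopingAlgebra.lift K r
  have hR : ∀ x, R (UniversalEnvelopingAlgebra.ι K x) = f x := fun x =>
    UniversalEnvelopingAlgebra.lift_ι_apply K r x
  let I : Submodule (Env K g) (Env K g) :=
    { carrier := {u | R u 1 = 0}
      zero_mem' := by
        change R 0 1 = 0
        rw [map_zero, LinearMap.zero_apply]
      add_mem' := fun {a b} (ha : R a 1 = 0) (hb : R b 1 = 0) => by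
        change R (a + b) 1 = 0
        rw [map_add, LinearMap.add_apply, ha, hb, add_zero]
      smul_mem' := fun c a (ha : R a 1 = 0) => by
        change R (c * a) 1 = 0
        rw [map_mul, Module.End.mul_apply, ha, map_zero] }
  have hI : S.vermaIdeal lam ≤ I := by
    refine Submodule.span_le.2 ?_
    rintro _ (⟨x, hx, rfl⟩ | ⟨H, rfl⟩)
    · change R _ 1 = 0
      have h := hf1 ⟨x, nplus_le_b hx⟩
      rw [extendToB_nplus lam hx, zero_smul] at h
      rw [hR]
      exact h
    · change R _ 1 = 0
      have h := hf1 ⟨H, h_le_b H.2⟩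
      rw [extendToB_h lam H rfl] at h
      rw [map_sub, LinearMap.sub_apply, hR, AlgHom.commutes, Module.algebraMap_end_apply]
      exact sub_eq_zero.2 h
  intro h
  have h1 : R 1 1 = 0 := hI h
  rw [map_one R] at h1
  exact one_ne_zero h1

end Triangular

section Weights

variable {K : Type} [Field K] [IsAlgClosed K] [CharZero K]
variable {g : Type} [LieRing g] [LieAlgebra K g] {S : Setup K g}
variable {M : Type} [AddCommGroup M] [Module K M] [Module (Env K g) M]
  [IsScalarTower K (Env K g) M]

theorem wle.trans {lam mu nu : Module.Dual K S.h} (h₁ : S.wle lam mu) (h₂ : S.wle mu nu) :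
    S.wle lam nu := by
  obtain ⟨s, hs, h⟩ := h₁
  obtain ⟨t, ht, h'⟩ := h₂
  refine ⟨s + t, fun β hβ => (Multiset.mem_add.1 hβ).elim (hs β) (ht β), ?_⟩
  rw [Multiset.sum_add, ← h, ← h']
  abel

theorem map_mem_wtSpace {M' : Type} [AddCommGroup M'] [Module K M'] [Module (Env K g) M']
    [IsScalarTower K (Env K g) M'] (f : M →ₗ[Env K g] M') {mu : Module.Dual K S.h} {x : M}
    (hx : x ∈ S.wtSpace M mu) : f x ∈ S.wtSpace M' mu := fun H => by
  rw [← map_smul, hx H, ← algebraMap_smul (Env K g) (mu H) x, map_smul, algebraMap_smul]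

theorem smul_mem_wtSpace {α mu : Module.Dual K S.h} {x : g} {m : M}
    (hx : x ∈ adWeightSpace K g S.h α) (hm : m ∈ S.wtSpace M mu) :
    UniversalEnvelopingAlgebra.ι K x • m ∈ S.wtSpace M (mu + α) := fun H => by
  let _ : LieRing (Env K g) := LieRing.ofAssociativeRing
  have h : UniversalEnvelopingAlgebra.ι K ⁅(H : g), x⁆ =
      UniversalEnvelopingAlgebra.ι K (H : g) * UniversalEnvelopingAlgebra.ι K x -
        UniversalEnvelopingAlgebra.ι K x * UniversalEnvelopingAlgebra.ι K (H : g) :=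
    LieHom.map_lie _ _ _
  have h' := hx H
  rw [h'] at h
  rw [map_smul, eq_sub_iff_add_eq] at h
  rw [← mul_smul, ← h, add_smul, mul_smul, hm H, env_smul_comm, smul_assoc,
    LinearMap.add_apply, add_smul, add_comm]

theorem mem_of_finsupp_sum_mem (N : Submodule (Env K g) M) (f : Module.Dual K S.h →₀ M)
    (hf : ∀ a, f a ∈ S.wtSpace M a) (hsum : (f.sum fun _ m => m) ∈ N) (a : Module.Dual K S.h) :
    f a ∈ N := by
  by_cases ha : a ∈ f.support
  · refine weight_components_mem (ι := S.h) (w := fun a H => a H)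
      (fun H => Module.toModuleEnd K (S := Env K g) M (UniversalEnvelopingAlgebra.ι K (H : g)))
      (N.restrictScalars K) (fun H m hm => N.smul_mem _ hm) f.support
      (fun a _ b _ h => LinearMap.ext fun H => congrFun h H) f (fun a _ H => hf a H) hsum a ha
  · rw [Finsupp.notMem_support_iff.1 ha]
    exact N.zero_mem

theorem exists_finsupp_of_mem_iSup {A : Set (Module.Dual K S.h)} {m : M}
    (hm : m ∈ ⨆ a ∈ A, S.wtSpace M a) : ∃ f : Module.Dual K S.h →₀ M,
      (∀ a, f a ∈ S.wtSpace M a) ∧ (∀ a ∉ A, f a = 0) ∧ (f.sum fun _ m => m) = m := by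
  classical
  refine Submodule.iSup_induction _ (motive := fun m => ∃ f : Module.Dual K S.h →₀ M,
      (∀ a, f a ∈ S.wtSpace M a) ∧ (∀ a ∉ A, f a = 0) ∧ (f.sum fun _ m => m) = m) hm
      (fun a m hm => ?_) ?_ ?_
  · by_cases ha : a ∈ A
    · rw [iSup_pos ha] at hm
      refine ⟨Finsupp.single a m, fun c => ?_, fun c hc => ?_, Finsupp.sum_single_index rfl⟩
      · rw [Finsupp.single_apply]
        split_ifs with h
        · exact h ▸ hm
        · exact zero_mem _
      · exact Finsupp.single_eq_of_ne fun h => hc (h ▸ ha)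
    · rw [iSup_neg ha, Submodule.mem_bot] at hm
      exact ⟨0, fun _ => zero_mem _, fun _ _ => rfl, by rw [hm, Finsupp.sum_zero_index]⟩
  · exact ⟨0, fun _ => zero_mem _, fun _ _ => rfl, Finsupp.sum_zero_index⟩
  · rintro _ _ ⟨f, hf, hA, rfl⟩ ⟨f', hf', hA', rfl⟩
    refine ⟨f + f', fun a => add_mem (hf a) (hf' a), fun a ha => ?_,
      Finsupp.sum_add_index' (fun _ => rfl) fun _ _ _ => rfl⟩
    rw [Finsupp.add_apply, hA a ha, hA' a ha, add_zero]

/-- If the class of a sum of weight vectors modulo `N` has weight `xi`, then it is the class of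
the component of weight `xi`. -/
theorem sub_mem_of_finsupp_sum (N : Submodule (Env K g) M) (f : Module.Dual K S.h →₀ M)
    (hf : ∀ a, f a ∈ S.wtSpace M a) {xi : Module.Dual K S.h} {x : M}
    (hx : N.mkQ x ∈ S.wtSpace (M ⧸ N) xi) (hsum : (f.sum fun _ m => m) - x ∈ N) :
    f xi - x ∈ N := by
  classical
  let f' : Module.Dual K S.h →₀ M ⧸ N :=
    f.mapRange N.mkQ (map_zero _) - Finsupp.single xi (N.mkQ x)
  have h := mem_of_finsupp_sum_mem (S := S) (⊥ : Submodule (Env K g) (M ⧸ N)) f' (fun a => ?_) ?_ xi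
  · rw [Submodule.mem_bot, Finsupp.sub_apply, Finsupp.single_eq_same, Finsupp.mapRange_apply,
      ← map_sub] at h
    exact (Submodule.Quotient.mk_eq_zero N).1 h
  · refine sub_mem (map_mem_wtSpace N.mkQ (hf a)) ?_
    rw [Finsupp.single_apply]
    split_ifs with h
    · exact h ▸ hx
    · exact zero_mem _
  · rw [Submodule.mem_bot, Finsupp.sum_sub_index (fun _ _ _ => rfl), Finsupp.sum_single_index rfl,
      Finsupp.sum_mapRange_index (fun _ => rfl), sub_eq_zero]
    rw [← sub_eq_zero, Finsupp.sum, ← map_sum, ← map_sub]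
    exact (Submodule.Quotient.mk_eq_zero N).2 hsum

theorem mem_of_wtSpace_ne_bot {A : Set (Module.Dual K S.h)}
    (h : (⨆ a ∈ A, S.wtSpace M a) = ⊤) {mu : Module.Dual K S.h} (hmu : S.wtSpace M mu ≠ ⊥) :
    mu ∈ A := by
  by_contra hA
  refine hmu ((Submodule.eq_bot_iff _).2 fun x hx => ?_)
  obtain ⟨f, hf, hA', hs⟩ := exists_finsupp_of_mem_iSup (S := S) (h ▸ Submodule.mem_top (x := x))
  have h1 := sub_mem_of_finsupp_sum (S := S) (⊥ : Submodule (Env K g) M) f hf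
    (map_mem_wtSpace (Submodule.mkQ _) hx) (by rw [hs, sub_self]; exact zero_mem _)
  rwa [hA' mu hA, zero_sub, Submodule.neg_mem_iff, Submodule.mem_bot] at h1

end Weights

section Verma

variable {K : Type} [Field K] [IsAlgClosed K] [CharZero K]
variable {g : Type} [LieRing g] [LieAlgebra K g] {S : Setup K g}

theorem IsDynkin.sum_ne_zero (hS : S.IsDynkin) {s : Multiset (Module.Dual K S.h)} (hs : s ≠ 0)
    (hpos : ∀ β ∈ s, β ∈ S.pos) : s.sum ≠ 0 := by
  intro h0
  obtain ⟨β, hβ⟩ := Multiset.exists_mem_of_ne_zero hs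
  have hsimple : ∀ α, ¬ S.IsSimpleRoot α := fun α hα => by
    refine hα.2 ⟨α ::ₘ s, ?_, ?_, by rw [Multiset.sum_cons, h0, add_zero]⟩
    · rw [Multiset.card_cons]
      have := Multiset.card_pos.2 hs
      omega
    · exact Multiset.forall_mem_cons.2 ⟨hα.1, hpos⟩
  have hb : S.b ≤ S.h := by
    rw [hS, LieSubalgebra.lieSpan_le]
    refine Set.union_subset subset_rfl (Set.iUnion₂_subset fun α hα => ?_)
    exact (hsimple α hα).elim
  have hβ' := S.pos_root β (hpos β hβ)
  refine hβ'.2 (disjoint_self.1 ((S.h_indep.pairwiseDisjoint hβ'.1).mono_right ?_))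
  change _ ≤ adWeightSpace K g S.h 0
  rw [S.adWeightSpace_zero]
  exact (adWeightSpace_le_adSum (hpos β hβ)).trans (nplus_le_b.trans hb)

/-- The weights strictly below `xi`. -/
def below (xi : Module.Dual K S.h) : Set (Module.Dual K S.h) :=
  {mu | ∃ s : Multiset (Module.Dual K S.h), s ≠ 0 ∧ (∀ β ∈ s, β ∈ S.pos) ∧ xi - mu = s.sum}

theorem IsDynkin.notMem_below (hS : S.IsDynkin) (xi : Module.Dual K S.h) : xi ∉ below xi := by
  rintro ⟨s, h0, hs, h⟩
  exact hS.sum_ne_zero h0 hs (by rw [← h, sub_self])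

theorem add_mem_below {xi mu α : Module.Dual K S.h} (hα : α ∈ S.negRoots)
    (hmu : mu = xi ∨ mu ∈ below xi) : mu + α ∈ below xi := by
  rcases hmu with rfl | ⟨s, -, hs, h⟩
  · refine ⟨{-α}, Multiset.singleton_ne_zero _, fun β hβ => ?_, ?_⟩
    · rw [Multiset.mem_singleton.1 hβ]
      exact neg_mem_pos hα
    · rw [Multiset.sum_singleton]
      abel
  · refine ⟨-α ::ₘ s, Multiset.cons_ne_zero,
      Multiset.forall_mem_cons.2 ⟨neg_mem_pos hα, hs⟩, ?_⟩
    rw [Multiset.sum_cons, ← h]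
    abel

theorem wle_of_eq_or_mem_below {xi mu : Module.Dual K S.h} (h : mu = xi ∨ mu ∈ below xi) :
    S.wle mu xi := by
  rcases h with rfl | ⟨s, -, hs, h⟩
  · exact ⟨0, by simp, by simp⟩
  · exact ⟨s, hs, h⟩

variable (S)

/-- The canonical generator of the Verma module. -/
def highestVector (xi : Module.Dual K S.h) : S.Verma xi := (S.vermaIdeal xi).mkQ 1

/-- The sum of the weight spaces of the Verma module with weight strictly below `xi`. -/
def lower (xi : Module.Dual K S.h) : Submodule K (S.Verma xi) :=
  ⨆ a ∈ below xi, S.wtSpace (S.Verma xi) a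

variable {S}

theorem highestVector_ne_zero (xi : Module.Dual K S.h) : S.highestVector xi ≠ 0 := fun h =>
  one_notMem_vermaIdeal xi ((Submodule.Quotient.mk_eq_zero _).1 h)

theorem smul_highestVector (xi : Module.Dual K S.h) (u : Env K g) :
    u • S.highestVector xi = (S.vermaIdeal xi).mkQ u := by
  rw [highestVector, ← map_smul, smul_eq_mul, mul_one]

theorem highestVector_mem (xi : Module.Dual K S.h) :
    S.highestVector xi ∈ S.wtSpace (S.Verma xi) xi := fun H => by
  rw [smul_highestVector, ← algebraMap_smul (Env K g) (xi H), smul_highestVector, ← sub_eq_zero,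
    ← map_sub]
  exact (Submodule.Quotient.mk_eq_zero _).2 (Submodule.subset_span (.inr ⟨H, rfl⟩))

theorem nplus_smul_highestVector (xi : Module.Dual K S.h) {x : g} (hx : x ∈ S.nplus) :
    UniversalEnvelopingAlgebra.ι K x • S.highestVector xi = 0 := by
  rw [smul_highestVector]
  exact (Submodule.Quotient.mk_eq_zero _).2 (Submodule.subset_span (.inl ⟨x, hx, rfl⟩))

theorem nminus_smul_mem_lower (xi : Module.Dual K S.h) {y : g} (hy : y ∈ S.nminus)
    {m : S.Verma xi} (hm : m ∈ K ∙ S.highestVector xi ⊔ S.lower xi) :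
    UniversalEnvelopingAlgebra.ι K y • m ∈ S.lower xi := by
  have key : ∀ α ∈ S.negRoots, ∀ y ∈ adWeightSpace K g S.h α, ∀ mu, (mu = xi ∨ mu ∈ below xi) →
      ∀ m ∈ S.wtSpace (S.Verma xi) mu, UniversalEnvelopingAlgebra.ι K y • m ∈ S.lower xi :=
    fun α hα y hy mu hmu m hm => Submodule.mem_iSup_of_mem (mu + α)
      (Submodule.mem_iSup_of_mem (add_mem_below hα hmu) (smul_mem_wtSpace hy hm))
  refine adSum_induction (p := fun y => UniversalEnvelopingAlgebra.ι K y • m ∈ S.lower xi)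
    (fun α hα y hy => ?_) ?_ ?_ hy
  · obtain ⟨a, ha, c, hc, rfl⟩ := Submodule.mem_sup.1 hm
    obtain ⟨t, rfl⟩ := Submodule.mem_span_singleton.1 ha
    rw [smul_add]
    refine add_mem (key α hα y hy xi (.inl rfl) _
      (Submodule.smul_mem _ _ (highestVector_mem xi))) ?_
    refine Submodule.iSup_induction _
      (motive := fun c => UniversalEnvelopingAlgebra.ι K y • c ∈ S.lower xi) hc
      (fun mu c hc => ?_) (by rw [smul_zero]; exact zero_mem _)
      fun a b ha hb => by rw [smul_add]; exact add_mem ha hb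
    refine Submodule.iSup_induction _
      (motive := fun c => UniversalEnvelopingAlgebra.ι K y • c ∈ S.lower xi) hc
      (fun hmu c hc => key α hα y hy mu (.inr hmu) c hc) (by rw [smul_zero]; exact zero_mem _)
      fun a b ha hb => by rw [smul_add]; exact add_mem ha hb
  · rw [map_zero, zero_smul]
    exact zero_mem _
  · intro a b ha hb
    rw [map_add, add_smul]
    exact add_mem ha hb

theorem span_highestVector_sup_lower (xi : Module.Dual K S.h) :
    K ∙ S.highestVector xi ⊔ S.lower xi = ⊤ := by
  let _ : LieRing (Env K g) := LieRing.ofAssociativeRing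
  let f : g →ₗ[K] Module.End K (S.Verma xi) :=
    LinearMap.mk₂ K (fun x m => UniversalEnvelopingAlgebra.ι K x • m)
      (fun x y m => by rw [map_add, add_smul]) (fun c x m => by rw [map_smul, smul_assoc])
      (fun x m m' => smul_add _ _ _) (fun c x m => env_smul_comm _ _ _)
  have hf : ∀ x m, f x m = UniversalEnvelopingAlgebra.ι K x • m := fun _ _ => rfl
  obtain ⟨N, hNP, hvN, hN⟩ := exists_stable_of_generator f
    (fun x y m => by
      rw [hf, hf, hf, hf, hf, LieHom.map_lie, LieRing.of_associative_ring_bracket, sub_smul,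
        mul_smul, mul_smul])
    S.b.toSubmodule S.nminus.toSubmodule S.isCompl_nminus_b.symm.sup_eq_top (S.highestVector xi)
    (fun x hx => by
      rw [S.b_eq] at hx
      obtain ⟨H, hH, c, hc, rfl⟩ := Submodule.mem_sup.1 hx
      have h1 := highestVector_mem xi ⟨H, hH⟩
      rw [hf, map_add, add_smul, nplus_smul_highestVector xi hc, add_zero, h1]
      exact Submodule.smul_mem _ _ (Submodule.mem_span_singleton_self _))
    _ (Submodule.mem_sup_left (Submodule.mem_span_singleton_self _))
    fun y hy m hm => Submodule.mem_sup_right (nminus_smul_mem_lower xi hy hm)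
  rw [eq_top_iff]
  refine le_trans (fun m _ => ?_) hNP
  obtain ⟨u, rfl⟩ := Submodule.mkQ_surjective _ m
  rw [← smul_highestVector]
  have h2 : ∀ u : Env K g, ∀ m ∈ N, u • m ∈ N := by
    refine UniversalEnvelopingAlgebra.induction_of_lie ?_ ?_ ?_ ?_ ?_
    · intro m hm
      rwa [one_smul]
    · intro m _
      rw [zero_smul]
      exact zero_mem _
    · intro u v hu hv m hm
      rw [add_smul]
      exact add_mem (hu m hm) (hv m hm)
    · intro c u hu m hm
      rw [smul_assoc]
      exact N.smul_mem c (hu m hm)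
    · intro y u hu m hm
      rw [mul_smul]
      exact hN y _ (hu m hm)
  exact h2 u _ hvN

theorem mem_lower_of_mem_of_ne_top {xi : Module.Dual K S.h} (hS : S.IsDynkin)
    {N : Submodule (Env K g) (S.Verma xi)} (hN : N ≠ ⊤) {m : S.Verma xi} (hm : m ∈ N) :
    m ∈ S.lower xi := by
  classical
  have hm' : m ∈ K ∙ S.highestVector xi ⊔ S.lower xi := by
    rw [span_highestVector_sup_lower]
    exact Submodule.mem_top
  obtain ⟨a, ha, c, hc, rfl⟩ := Submodule.mem_sup.1 hm'
  obtain ⟨t, rfl⟩ := Submodule.mem_span_singleton.1 ha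
  obtain ⟨f, hf, hA, hs⟩ := exists_finsupp_of_mem_iSup hc
  have h := mem_of_finsupp_sum_mem N (Finsupp.single xi (t • S.highestVector xi) + f) (fun a => ?_)
    ?_ xi
  · rw [Finsupp.add_apply, Finsupp.single_eq_same, hA xi (hS.notMem_below xi), add_zero] at h
    by_cases ht : t = 0
    · rw [ht, zero_smul, zero_add]
      exact hc
    · refine (hN ?_).elim
      rw [eq_top_iff]
      intro m _
      obtain ⟨u, rfl⟩ := Submodule.mkQ_surjective _ m
      rw [← smul_highestVector]
      refine N.smul_mem u ?_
      have h1 := (N.restrictScalars K).smul_mem t⁻¹ h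
      rwa [smul_smul, inv_mul_cancel₀ ht, one_smul] at h1
  · refine add_mem ?_ (hf a)
    rw [Finsupp.single_apply]
    split_ifs with h
    · exact h ▸ Submodule.smul_mem _ _ (highestVector_mem xi)
    · exact zero_mem _
  · rw [Finsupp.sum_add_index' (fun _ => rfl) fun _ _ _ => rfl, Finsupp.sum_single_index rfl, hs]
    exact hm

theorem highestVector_notMem_lower {xi : Module.Dual K S.h} (hS : S.IsDynkin) :
    S.highestVector xi ∉ S.lower xi := by
  intro h
  obtain ⟨f, hf, hA, hs⟩ := exists_finsupp_of_mem_iSup h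
  have h1 := sub_mem_of_finsupp_sum (⊥ : Submodule (Env K g) (S.Verma xi)) f hf
    (map_mem_wtSpace (Submodule.mkQ _) (highestVector_mem xi))
    (by rw [hs, sub_self]; exact zero_mem _)
  rw [hA xi (hS.notMem_below xi), zero_sub, Submodule.neg_mem_iff, Submodule.mem_bot] at h1
  exact highestVector_ne_zero xi h1

theorem maxSub_le_lower {xi : Module.Dual K S.h} (hS : S.IsDynkin) {m : S.Verma xi}
    (hm : m ∈ S.maxSub xi) : m ∈ S.lower xi := by
  rw [maxSub, sSup_eq_iSup'] at hm
  exact Submodule.iSup_induction _ (motive := (· ∈ S.lower xi)) hm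
    (fun N m hm => mem_lower_of_mem_of_ne_top hS N.2 hm) (zero_mem _) fun _ _ => add_mem

theorem IsDynkin.isSimpleModule (hS : S.IsDynkin) (xi : Module.Dual K S.h) :
    IsSimpleModule (Env K g) (S.SimpleL xi) := by
  rw [isSimpleModule_iff_isCoatom]
  refine ⟨fun h => highestVector_notMem_lower hS (maxSub_le_lower hS (h ▸ Submodule.mem_top)),
    fun N hN => ?_⟩
  by_contra h
  exact hN.not_ge (le_sSup h)

theorem IsDynkin.wtSpace_simpleL_ne_bot (hS : S.IsDynkin) (xi : Module.Dual K S.h) :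
    S.wtSpace (S.SimpleL xi) xi ≠ ⊥ := by
  intro h
  have h1 := map_mem_wtSpace (S.maxSub xi).mkQ (highestVector_mem xi)
  rw [h, Submodule.mem_bot] at h1
  exact highestVector_notMem_lower hS
    (maxSub_le_lower hS ((Submodule.Quotient.mk_eq_zero _).1 h1))

theorem wle_of_wtSpace_simpleL_ne_bot {xi mu : Module.Dual K S.h}
    (h : S.wtSpace (S.SimpleL xi) mu ≠ ⊥) : S.wle mu xi := by
  refine wle_of_eq_or_mem_below (mem_of_wtSpace_ne_bot (A := {mu | mu = xi ∨ mu ∈ below xi}) ?_ h)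
  rw [eq_top_iff]
  rintro m -
  obtain ⟨m, rfl⟩ := Submodule.mkQ_surjective _ m
  have hm' : m ∈ K ∙ S.highestVector xi ⊔ S.lower xi := by
    rw [span_highestVector_sup_lower]
    exact Submodule.mem_top
  obtain ⟨a, ha, c, hc, rfl⟩ := Submodule.mem_sup.1 hm'
  obtain ⟨t, rfl⟩ := Submodule.mem_span_singleton.1 ha
  have key : ∀ mu, (mu = xi ∨ mu ∈ below xi) → ∀ m ∈ S.wtSpace (S.Verma xi) mu,
      (S.maxSub xi).mkQ m ∈ ⨆ a ∈ {mu | mu = xi ∨ mu ∈ below xi}, S.wtSpace (S.SimpleL xi) a :=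
    fun mu hmu m hm => Submodule.mem_iSup_of_mem mu
      (Submodule.mem_iSup_of_mem hmu (map_mem_wtSpace _ hm))
  rw [map_add]
  refine add_mem (key xi (.inl rfl) _ (Submodule.smul_mem _ _ (highestVector_mem xi))) ?_
  obtain ⟨f, hf, hA, rfl⟩ := exists_finsupp_of_mem_iSup hc
  rw [Finsupp.sum, map_sum]
  refine sum_mem fun a _ => ?_
  by_cases ha : a ∈ below xi
  · exact key a (.inr ha) _ (hf a)
  · rw [hA a ha, map_zero]
    exact zero_mem _

end Verma

section Butterfly

variable {K : Type} [Field K] [IsAlgClosed K] [CharZero K]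
variable {g : Type} [LieRing g] [LieAlgebra K g] {S : Setup K g}
variable {M : Type} [AddCommGroup M] [Module K M] [Module (Env K g) M]
  [IsScalarTower K (Env K g) M]

theorem exists_mem_wtSpace_of_quotient (hM : (⨆ a, S.wtSpace M a) = ⊤)
    {A E : Submodule (Env K g) M} {xi : Module.Dual K S.h} {d : M} (hdE : d ∈ E) (hdA : d ∉ A)
    (hd : A.mkQ d ∈ S.wtSpace (M ⧸ A) xi) : ∃ x ∈ E, x ∉ A ∧ x ∈ S.wtSpace M xi := by
  have hd' : d ∈ ⨆ a ∈ (Set.univ : Set (Module.Dual K S.h)), S.wtSpace M a := by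
    rw [iSup_univ, hM]
    exact Submodule.mem_top
  obtain ⟨f, hf, -, hs⟩ := exists_finsupp_of_mem_iSup hd'
  have h := sub_mem_of_finsupp_sum A f hf hd (by rw [hs, sub_self]; exact zero_mem _)
  exact ⟨f xi, mem_of_finsupp_sum_mem E f hf (by rwa [hs]) xi,
    fun h' => hdA ((A.sub_mem_iff_right h').1 h), hf xi⟩

theorem wtSpace_ne_bot_of_equiv {X Y : Type} [AddCommGroup X] [Module K X] [Module (Env K g) X]
    [IsScalarTower K (Env K g) X] [AddCommGroup Y] [Module K Y] [Module (Env K g) Y]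
    [IsScalarTower K (Env K g) Y] (e : X ≃ₗ[Env K g] Y) {mu : Module.Dual K S.h}
    (h : S.wtSpace X mu ≠ ⊥) : S.wtSpace Y mu ≠ ⊥ := by
  obtain ⟨x, hx, h0⟩ := Submodule.exists_mem_ne_zero_of_ne_bot h
  intro h'
  have h1 := map_mem_wtSpace e.toLinearMap hx
  rw [h', Submodule.mem_bot] at h1
  exact h0 (e.map_eq_zero_iff.1 h1)

theorem subQuot_equiv_of_sup_eq {A B E X : Submodule (Env K g) M} (h : A ⊔ E = B)
    (hX : A ⊓ E = X) : Nonempty (subQuot X E ≃ₗ[Env K g] subQuot A B) := by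
  rw [sup_comm] at h
  subst h hX
  refine ⟨(Submodule.quotEquivOfEq _ _ ?_).trans (LinearMap.quotientInfEquivSupQuotient E A)⟩
  rw [Submodule.comap_inf, inf_comm]

theorem sup_eq_of_isSimpleModule_subQuot {A B E : Submodule (Env K g) M} (hAB : A ≤ B)
    (h : IsSimpleModule (Env K g) (subQuot A B)) (hEB : E ≤ B) (hEA : ¬ E ≤ A) : A ⊔ E = B :=
  (((covBy_iff_quot_is_simple hAB).2 h).eq_or_eq le_sup_left (sup_le hAB hEB)).resolve_left
    fun h => hEA (le_sup_right.trans h.le)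

/-- Two simple subquotients `B/A` and `D/C` such that `D` is the first step of its chain
meeting `B` outside of `A` are isomorphic. -/
theorem subQuot_equiv_of_inf_le {A B C D : Submodule (Env K g) M} (hAB : A ≤ B) (hCD : C ≤ D)
    (h₁ : IsSimpleModule (Env K g) (subQuot A B)) (h₂ : IsSimpleModule (Env K g) (subQuot C D))
    (hD : ¬ B ⊓ D ≤ A) (hC : B ⊓ C ≤ A) :
    A ⊓ D ≤ C ∧ Nonempty (subQuot A B ≃ₗ[Env K g] subQuot C D) := by
  have hDC : ¬ B ⊓ D ≤ C := fun h => hD ((le_inf inf_le_left h).trans hC)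
  have hle : C ⊓ (B ⊓ D) ≤ A ⊓ (B ⊓ D) :=
    le_inf ((le_inf (inf_le_right.trans inf_le_left) inf_le_left).trans hC) inf_le_right
  obtain ⟨e₁⟩ := subQuot_equiv_of_sup_eq
    (sup_eq_of_isSimpleModule_subQuot hAB h₁ (inf_le_left (b := D)) hD) rfl
  obtain ⟨e₂⟩ := subQuot_equiv_of_sup_eq
    (sup_eq_of_isSimpleModule_subQuot hCD h₂ (inf_le_right (a := B)) hDC) rfl
  have hcov : C ⊓ (B ⊓ D) ⋖ B ⊓ D :=
    (covBy_iff_quot_is_simple inf_le_right).2 (IsSimpleModule.congr e₂)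
  have heq : A ⊓ (B ⊓ D) = C ⊓ (B ⊓ D) :=
    (hcov.eq_or_eq hle inf_le_right).resolve_right fun h => hD (inf_eq_right.1 h)
  refine ⟨?_, ⟨e₁.symm.trans ((Submodule.quotEquivOfEq _ _ (by rw [heq])).trans e₂)⟩⟩
  calc A ⊓ D ≤ A ⊓ (B ⊓ D) := le_inf inf_le_left (inf_le_inf_right D hAB)
    _ = C ⊓ (B ⊓ D) := heq
    _ ≤ C := inf_le_left

theorem exists_mem_wtSpace_of_subQuot (hM : (⨆ a, S.wtSpace M a) = ⊤)
    {A B E : Submodule (Env K g) M} (hE : A ⊔ E = B) {xi : Module.Dual K S.h}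
    (h : S.wtSpace (subQuot A B) xi ≠ ⊥) : ∃ x ∈ E, x ∉ A ∧ x ∈ S.wtSpace M xi := by
  obtain ⟨y, hy, h0⟩ := Submodule.exists_mem_ne_zero_of_ne_bot h
  obtain ⟨⟨z, hz⟩, rfl⟩ := Submodule.mkQ_surjective _ y
  obtain ⟨a, ha, d, hd, had⟩ := Submodule.mem_sup.1 (hE ▸ hz)
  have h1 := map_mem_wtSpace (Submodule.mapQ (A.comap B.subtype) A B.subtype le_rfl) hy
  have h2 : A.mkQ z ∈ S.wtSpace (M ⧸ A) xi := h1
  have h3 : A.mkQ a = 0 := (Submodule.Quotient.mk_eq_zero A).2 ha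
  rw [← had, map_add, h3, zero_add] at h2
  refine exists_mem_wtSpace_of_quotient hM hd (fun hdA => h0 ?_) h2
  exact (Submodule.Quotient.mk_eq_zero _).2 (show z ∈ A from had ▸ add_mem ha hdA)

theorem wtSpace_subQuot_ne_bot {C D : Submodule (Env K g) M} {xi : Module.Dual K S.h} {x : M}
    (hxD : x ∈ D) (hxC : x ∉ C) (hx : x ∈ S.wtSpace M xi) : S.wtSpace (subQuot C D) xi ≠ ⊥ := by
  intro h
  have h1 : (⟨x, hxD⟩ : D) ∈ S.wtSpace D xi := fun H => Subtype.ext (hx H)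
  have h2 := map_mem_wtSpace (C.comap D.subtype).mkQ h1
  rw [h, Submodule.mem_bot] at h2
  have h3 : (⟨x, hxD⟩ : D) ∈ C.comap D.subtype := (Submodule.Quotient.mk_eq_zero _).1 h2
  exact hxC h3

theorem _root_.Fin.exists_not_castSucc_and_succ {k : ℕ} {p : Fin (k + 1) → Prop} (h0 : ¬ p 0)
    (hl : p (Fin.last k)) : ∃ i : Fin k, ¬ p i.castSucc ∧ p i.succ := by
  by_contra! h
  exact Fin.induction (motive := fun i => ¬ p i) h0 h (Fin.last k) hl

variable {lam nu : Module.Dual K S.h}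

/-- The `i`-th step of `T₂` is the one at which the `j`-th subquotient of `T₁` appears. -/
def CompSeries.Matches (T₁ T₂ : S.CompSeries lam nu M) (j : Fin T₁.k) (i : Fin T₂.k) : Prop :=
  ¬ T₁.c j.succ ⊓ T₂.c i.succ ≤ T₁.c j.castSucc ∧
    T₁.c j.succ ⊓ T₂.c i.castSucc ≤ T₁.c j.castSucc ∧
    T₁.c j.castSucc ⊓ T₂.c i.succ ≤ T₂.c i.castSucc

theorem CompSeries.Matches.symm {T₁ T₂ : S.CompSeries lam nu M} {j : Fin T₁.k} {i : Fin T₂.k}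
    (h : T₁.Matches T₂ j i) : T₂.Matches T₁ i j := by
  obtain ⟨h1, h2, h3⟩ := h
  refine ⟨fun h => h1 ((le_inf inf_le_left ?_).trans h2), ?_, ?_⟩
  · rwa [inf_comm]
  · rwa [inf_comm]
  · rwa [inf_comm]

theorem CompSeries.Matches.eq {T₁ T₂ : S.CompSeries lam nu M} {j : Fin T₁.k} {i i' : Fin T₂.k}
    (h : T₁.Matches T₂ j i) (h' : T₁.Matches T₂ j i') : i = i' := by
  have key : ∀ {i i' : Fin T₂.k}, T₁.Matches T₂ j i → T₁.Matches T₂ j i' → ¬ i < i' :=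
    fun h h' hlt => h.1 ((inf_le_inf_left _ (T₂.mono (Fin.succ_le_castSucc_iff.2 hlt))).trans h'.2.1)
  exact le_antisymm (not_lt.1 (key h' h)) (not_lt.1 (key h h'))

theorem CompSeries.exists_matches (hS : S.IsDynkin) (hM : (⨆ a, S.wtSpace M a) = ⊤)
    (T₁ T₂ : S.CompSeries lam nu M) {j : Fin T₁.k} (hj : j ∈ T₁.J) :
    ∃ i ∈ T₂.J, T₁.Matches T₂ j i ∧ Nonempty (T₁.quot j ≃ₗ[Env K g] T₂.quot i) := by
  obtain ⟨xi, hlxi, hxin, ⟨e⟩⟩ := T₁.rel j hj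
  have hstep : ∀ T : S.CompSeries lam nu M, ∀ i : Fin T.k,
      T.c i.castSucc ≤ T.c i.succ :=
    fun T i => T.mono (Fin.castSucc_le_succ i)
  have hL := hS.isSimpleModule xi
  have h₁ : IsSimpleModule (Env K g) (T₁.quot j) := IsSimpleModule.congr e
  have hwt : S.wtSpace (T₁.quot j) xi ≠ ⊥ :=
    wtSpace_ne_bot_of_equiv e.symm (hS.wtSpace_simpleL_ne_bot xi)
  obtain ⟨i, hi, hi'⟩ := Fin.exists_not_castSucc_and_succ
    (p := fun i => ¬ T₁.c j.succ ⊓ T₂.c i ≤ T₁.c j.castSucc) (by simp [T₂.bot]) (by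
      rw [T₂.top, inf_top_eq]
      exact ((covBy_iff_quot_is_simple (hstep T₁ j)).2 h₁).lt.not_ge)
  rw [not_not] at hi
  obtain ⟨x, hx, hxA, hxwt⟩ := exists_mem_wtSpace_of_subQuot hM
    (sup_eq_of_isSimpleModule_subQuot (hstep T₁ j) h₁ inf_le_left hi') hwt
  have hwt₂ : S.wtSpace (T₂.quot i) xi ≠ ⊥ :=
    wtSpace_subQuot_ne_bot hx.2 (fun h => hxA (hi ⟨hx.1, h⟩)) hxwt
  have hmatch : IsSimpleModule (Env K g) (T₂.quot i) →
      T₁.Matches T₂ j i ∧ Nonempty (T₁.quot j ≃ₗ[Env K g] T₂.quot i) := fun h₂ => by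
    obtain ⟨h3, h4⟩ := subQuot_equiv_of_inf_le (hstep T₁ j) (hstep T₂ i) h₁ h₂ hi' hi
    exact ⟨⟨hi', hi, h3⟩, h4⟩
  by_cases hiJ : i ∈ T₂.J
  · obtain ⟨xi', -, -, ⟨e'⟩⟩ := T₂.rel i hiJ
    have := hS.isSimpleModule xi'
    exact ⟨i, hiJ, hmatch (IsSimpleModule.congr e')⟩
  · exfalso
    rcases T₂.irrel i hiJ with h | ⟨xi', -, -, hnu, ⟨e'⟩⟩
    · exact hwt₂ (h xi hlxi hxin)
    · have := hS.isSimpleModule xi'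
      obtain ⟨-, ⟨f⟩⟩ := hmatch (IsSimpleModule.congr e')
      exact hnu ((wle_of_wtSpace_simpleL_ne_bot (wtSpace_ne_bot_of_equiv
        ((e'.symm.trans f.symm).trans e) (hS.wtSpace_simpleL_ne_bot xi'))).trans hxin)

end Butterfly

end Setup

/-- Any two composition series of `M ∈ O-bar` with bounds `lam ≼ nu`
are equivalent: there is a bijection between the relevant index sets matching isomorphic
subquotients. -/
theorem compSeries_with_bounds_equivalent
    (K : Type) [Field K] [IsAlgClosed K] [CharZero K]
    (g : Type) [LieRing g] [LieAlgebra K g] (S : Setup K g) (hDynkin : S.IsDynkin)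
    (M : Type) [AddCommGroup M] [Module K M] [Module (Env K g) M]
    [IsScalarTower K (Env K g) M] (hM : S.InO M)
    (lam nu : Module.Dual K S.h) (hln : S.wle lam nu)
    (T₁ T₂ : S.CompSeries lam nu M) :
    ∃ f : {j : Fin T₁.k // j ∈ T₁.J} ≃ {j : Fin T₂.k // j ∈ T₂.J},
      ∀ j : {j : Fin T₁.k // j ∈ T₁.J},
        Nonempty (T₁.quot j.1 ≃ₗ[Env K g] T₂.quot (f j).1) := by
  choose f hfJ hf hfe using fun j : {j : Fin T₁.k // j ∈ T₁.J} =>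
    T₁.exists_matches hDynkin hM.span T₂ j.2
  refine ⟨Equiv.ofBijective (fun j => ⟨f j, hfJ j⟩) ⟨fun j j' h => ?_, fun i => ?_⟩, hfe⟩
  · have h' : f j = f j' := congrArg Subtype.val h
    exact Subtype.ext ((hf j).symm.eq (h' ▸ (hf j').symm))
  · obtain ⟨j, hj, h, -⟩ := T₂.exists_matches hDynkin hM.span T₁ i.2
    exact ⟨⟨j, hj⟩, Subtype.ext ((hf ⟨j, hj⟩).eq h.symm)⟩

end Paper
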